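/- arXiv:1103.0868 — 4 statements merged into one kernel-verified Lean document; each statement's English description precedes it below -/
import Mathlib

section
/- Let χ be a weighted game on n voters with exactly two types of voters, with equivalence classes N1 (each of whose voters is at least as desirable as every voter of the other class) of size n1 and N2 of size n2. Then χ admits a minimum integer representation [q; w]; moreover this representation is constant on N1 and on N2, satisfies w i ≤ max(n1 + 1, n2) for all i ∈ N1 and w i ≤ max(n1, n2 − 1) for all i ∈ N2, and its quota can be chosen with q ≤ (n1 + n2) · max(n1 + 1, n2). -/
def SimpleGame (n : ℕ) (χ : Finset (Fin n) → Prop) : Prop :=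
  (∀ U V : Finset (Fin n), U ⊆ V → χ U → χ V) ∧ ¬ χ (∅ : Finset (Fin n)) ∧ χ Finset.univ

def IsRep {n : ℕ} (χ : Finset (Fin n) → Prop) (q : ℕ) (w : Fin n → ℕ) : Prop :=
  ∀ U : Finset (Fin n), χ U ↔ q ≤ ∑ i ∈ U, w i

def IsWeighted {n : ℕ} (χ : Finset (Fin n) → Prop) : Prop :=
  ∃ q w, IsRep χ q w

def MinRep {n : ℕ} (χ : Finset (Fin n) → Prop) (q : ℕ) (w : Fin n → ℕ) : Prop :=
  IsRep χ q w ∧ ∀ q' w', IsRep χ q' w' → ∀ i, w i ≤ w' i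

def Desir {n : ℕ} (χ : Finset (Fin n) → Prop) (i j : Fin n) : Prop :=
  ∀ U : Finset (Fin n), j ∈ U → i ∉ U → χ U → χ (insert i (U.erase j))

def VEquiv {n : ℕ} (χ : Finset (Fin n) → Prop) (i j : Fin n) : Prop :=
  Desir χ i j ∧ Desir χ j i

def StrictDesir {n : ℕ} (χ : Finset (Fin n) → Prop) (i j : Fin n) : Prop :=
  Desir χ i j ∧ ¬ Desir χ j i

def NullVoter {n : ℕ} (χ : Finset (Fin n) → Prop) (i : Fin n) : Prop :=
  ∀ U : Finset (Fin n), χ (insert i U) ↔ χ U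

def ShiftMinWin {n : ℕ} (χ : Finset (Fin n) → Prop) (U : Finset (Fin n)) : Prop :=
  χ U ∧ (∀ i ∈ U, ¬ χ (U.erase i)) ∧
    ∀ i ∈ U, ∀ j, j ∉ U → StrictDesir χ i j → ¬ χ (insert j (U.erase i))

def ShiftMaxLose {n : ℕ} (χ : Finset (Fin n) → Prop) (U : Finset (Fin n)) : Prop :=
  ¬ χ U ∧ (∀ j, j ∉ U → χ (insert j U)) ∧
    ∀ j ∈ U, ∀ i, i ∉ U → StrictDesir χ i j → χ (insert i (U.erase j))

def TwoTypes {n : ℕ} (χ : Finset (Fin n) → Prop) (N1 N2 : Finset (Fin n)) : Prop :=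
  N1.Nonempty ∧ N2.Nonempty ∧ Disjoint N1 N2 ∧ N1 ∪ N2 = Finset.univ ∧
  (∀ i ∈ N1, ∀ j ∈ N1, VEquiv χ i j) ∧
  (∀ i ∈ N2, ∀ j ∈ N2, VEquiv χ i j) ∧
  (∀ i ∈ N1, ∀ j ∈ N2, StrictDesir χ i j)

noncomputable def NumWinTypes2 {n : ℕ} (χ : Finset (Fin n) → Prop) (N1 N2 : Finset (Fin n)) : ℕ :=
  Set.ncard {p : ℕ × ℕ | ∃ U, ShiftMinWin χ U ∧ p = ((U ∩ N1).card, (U ∩ N2).card)}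

def LPFeasible {n : ℕ} (χ : Finset (Fin n) → Prop) (N1 N2 : Finset (Fin n))
    (w1 w2 q : ℝ) : Prop :=
  0 ≤ w1 ∧ 0 ≤ w2 ∧ 0 ≤ q ∧
  (∀ U, ShiftMinWin χ U → q ≤ ((U ∩ N1).card : ℝ) * w1 + ((U ∩ N2).card : ℝ) * w2) ∧
  (∀ U, ShiftMaxLose χ U → ((U ∩ N1).card : ℝ) * w1 + ((U ∩ N2).card : ℝ) * w2 ≤ q - 1)

def GameIso (n : ℕ) (χ χ' : Finset (Fin n) → Prop) : Prop :=
  ∃ σ : Equiv.Perm (Fin n), ∀ U : Finset (Fin n), χ' U ↔ χ (U.image σ)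

noncomputable def NumTypes (n : ℕ) (χ : Finset (Fin n) → Prop) : ℕ :=
  Set.ncard {S : Set (Fin n) | ∃ i, S = {j | VEquiv χ i j}}

noncomputable def ClassCount (n : ℕ) (χ : Finset (Fin n) → Prop) (U : Finset (Fin n)) (i : Fin n) : ℕ :=
  Set.ncard {j : Fin n | j ∈ U ∧ VEquiv χ i j}

def SameType (n : ℕ) (χ : Finset (Fin n) → Prop) (U V : Finset (Fin n)) : Prop :=
  ∀ i, ClassCount n χ U i = ClassCount n χ V i

noncomputable def NumSMWTypes (n : ℕ) (χ : Finset (Fin n) → Prop) : ℕ :=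
  Set.ncard {T : Set (Finset (Fin n)) | ∃ U, ShiftMinWin χ U ∧
    T = {V | ShiftMinWin χ V ∧ SameType n χ U V}}

noncomputable def wmntr (n t r : ℕ) : ℕ :=
  Set.ncard {C : Set (Finset (Fin n) → Prop) | ∃ χ, SimpleGame n χ ∧ IsWeighted χ ∧
    NumTypes n χ = t ∧ NumSMWTypes n χ = r ∧ C = {χ' | GameIso n χ χ'}}

noncomputable def wmnt (n t : ℕ) : ℕ :=
  Set.ncard {C : Set (Finset (Fin n) → Prop) | ∃ χ, SimpleGame n χ ∧ IsWeighted χ ∧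
    NumTypes n χ = t ∧ C = {χ' | GameIso n χ χ'}}

def PreservesTypes {n : ℕ} (χ : Finset (Fin n) → Prop) (w : Fin n → ℕ) : Prop :=
  ∀ i j, VEquiv χ i j → w i = w j

def MinRepPT {n : ℕ} (χ : Finset (Fin n) → Prop) (q : ℕ) (w : Fin n → ℕ) : Prop :=
  IsRep χ q w ∧ PreservesTypes χ w ∧
    ∀ q' w', IsRep χ q' w' → PreservesTypes χ w' → ∀ i, w i ≤ w' i

def Repre (a b k : ℕ) : Prop := ∃ u v : ℕ, u * a + v * b = k

def Wvec (t a b : ℕ) (l : Fin t → ℕ) (k : Fin t) : Fin (t + b + a) → ℕ :=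
  fun i => if h : (i : ℕ) < t then
      (a * b - l ⟨(i : ℕ), h⟩ - 1) + (if (i : ℕ) = (k : ℕ) then 0 else 1)
    else if (i : ℕ) < t + b then a else b

/-- Differences of a winning and a losing grid point. -/
def DD (n1 n2 : ℤ) (Win : ℤ → ℤ → Prop) (k l : ℤ) : Prop :=
  ∃ x y x' y' : ℤ, (0 ≤ x ∧ x ≤ n1 ∧ 0 ≤ y ∧ y ≤ n2) ∧ (0 ≤ x' ∧ x' ≤ n1 ∧ 0 ≤ y' ∧ y' ≤ n2) ∧
    Win x y ∧ ¬ Win x' y' ∧ k = x - x' ∧ l = y - y'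

def FF (n1 n2 : ℤ) (Win : ℤ → ℤ → Prop) (a b : ℤ) : Prop :=
  ∀ k l, DD n1 n2 Win k l → 1 ≤ k * a + l * b

lemma DD.swap {n1 n2 : ℤ} {Win : ℤ → ℤ → Prop} {k l : ℤ} (h : DD n1 n2 Win k l) :
    DD n2 n1 (fun x y => Win y x) l k := by
  obtain ⟨x, y, x', y', h1, h2, h3, h4, h5, h6⟩ := h
  exact ⟨y, x, y', x', by tauto, by tauto, h3, h4, h6, h5⟩

lemma conv_aux (n x s : ℤ) (m : ℕ) (h0 : 0 ≤ x) (h1 : x ≤ n)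
    (h2 : 0 ≤ x + ((m : ℤ) + 1) * s) (h3 : x + ((m : ℤ) + 1) * s ≤ n) :
    0 ≤ x + s ∧ x + s ≤ n := by
  have hm : (0 : ℤ) ≤ m := by positivity
  rcases le_total 0 s with h | h
  · have := mul_nonneg hm h
    constructor <;> nlinarith
  · have := mul_nonneg hm (neg_nonneg.2 h)
    constructor <;> nlinarith

lemma walk (n1 n2 : ℤ) (Win : ℤ → ℤ → Prop) (s t : ℤ) (m : ℕ) : ∀ x y : ℤ,
    (0 ≤ x ∧ x ≤ n1 ∧ 0 ≤ y ∧ y ≤ n2) →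
    (0 ≤ x + ((m : ℤ) + 1) * s ∧ x + ((m : ℤ) + 1) * s ≤ n1 ∧
      0 ≤ y + ((m : ℤ) + 1) * t ∧ y + ((m : ℤ) + 1) * t ≤ n2) →
    ¬ Win x y → Win (x + ((m : ℤ) + 1) * s) (y + ((m : ℤ) + 1) * t) → DD n1 n2 Win s t := by
  induction m with
  | zero =>
    intro x y h1 h2 h3 h4
    exact ⟨_, _, x, y, h2, h1, h4, h3, by push_cast; ring, by push_cast; ring⟩
  | succ m ih =>
    intro x y h1 h2 h3 h4
    have c1 := conv_aux n1 x s (m+1) h1.1 h1.2.1 h2.1 h2.2.1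
    have c2 := conv_aux n2 y t (m+1) h1.2.2.1 h1.2.2.2 h2.2.2.1 h2.2.2.2
    by_cases hw : Win (x + s) (y + t)
    · exact ⟨_, _, x, y, ⟨c1.1, c1.2, c2.1, c2.2⟩, h1, hw, h3, by ring, by ring⟩
    · have e1 : x + (((m + 1 : ℕ) : ℤ) + 1) * s = x + s + ((m : ℤ) + 1) * s := by push_cast; ring
      have e2 : y + (((m + 1 : ℕ) : ℤ) + 1) * t = y + t + ((m : ℤ) + 1) * t := by push_cast; ring
      rw [e1, e2] at h2 h4
      exact ih _ _ ⟨c1.1, c1.2, c2.1, c2.2⟩ h2 hw h4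

lemma parent (n1 n2 : ℤ) (Win : ℤ → ℤ → Prop) (c d e f : ℤ) (hc : 0 ≤ c) (hd : 0 ≤ d)
    (he : 0 ≤ e) (hf : 0 ≤ f) (hdet : d * e = c * f + 1) (hF : FF n1 n2 Win (c + e) (d + f))
    (k l : ℤ) (hD : DD n1 n2 Win k l) (hkl : k * c + l * d ≤ 0) : DD n1 n2 Win d (-c) := by
  have hm := hF k l hD
  obtain ⟨x, y, x', y', h1, h2, h3, h4, h5, h6⟩ := hD
  obtain ⟨u, hu⟩ : ∃ u : ℤ, u = -(k * c + l * d) := ⟨_, rfl⟩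
  obtain ⟨m, hmm⟩ : ∃ m : ℤ, m = k * (c + e) + l * (d + f) := ⟨_, rfl⟩
  have hu0 : 0 ≤ u := by omega
  have hm1 : 1 ≤ m := by omega
  have hk : k = m * d + u * (d + f) := by
    rw [hu, hmm]; linear_combination (-k) * hdet
  have hl : l = -(m * c + u * (c + e)) := by
    rw [hu, hmm]; linear_combination (-l) * hdet
  have p1 : 0 ≤ m * d := by positivity
  have p2 : 0 ≤ u * (d + f) := by positivity
  have p3 : 0 ≤ m * c := by positivity
  have p4 : 0 ≤ u * (c + e) := by positivity
  have b0 : 0 ≤ x' + u * (d + f) ∧ x' + u * (d + f) ≤ n1 ∧ 0 ≤ y' - u * (c + e) ∧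
      y' - u * (c + e) ≤ n2 := by
    refine ⟨?_, ?_, ?_, ?_⟩ <;> linarith [h1.1, h1.2.1, h1.2.2.1, h1.2.2.2, h2.1, h2.2.1, h2.2.2.1, h2.2.2.2]
  have hl0 : ¬ Win (x' + u * (d + f)) (y' - u * (c + e)) := by
    intro hw
    have := hF _ _ ⟨_, _, x', y', b0, h2, hw, h4, rfl, rfl⟩
    ring_nf at this
    omega
  obtain ⟨j, hj⟩ : ∃ j : ℕ, m = (j : ℤ) + 1 := ⟨(m - 1).toNat, by omega⟩
  have e1 : x' + u * (d + f) + ((j : ℤ) + 1) * d = x := by rw [← hj]; linarith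
  have e2 : y' - u * (c + e) + ((j : ℤ) + 1) * (-c) = y := by rw [← hj]; linarith
  exact walk n1 n2 Win d (-c) j _ _ b0 (by rw [e1, e2]; exact h1) hl0 (by rw [e1, e2]; exact h3)

lemma parent' (n1 n2 : ℤ) (Win : ℤ → ℤ → Prop) (c d e f : ℤ) (hc : 0 ≤ c) (hd : 0 ≤ d)
    (he : 0 ≤ e) (hf : 0 ≤ f) (hdet : d * e = c * f + 1) (hF : FF n1 n2 Win (c + e) (d + f))
    (k l : ℤ) (hD : DD n1 n2 Win k l) (hkl : k * e + l * f ≤ 0) : DD n1 n2 Win (-f) e := by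
  have := parent n2 n1 (fun x y => Win y x) f e d c hf he hd hc (by linarith)
    (by
      intro k' l' h'
      have := hF _ _ h'.swap
      linarith) l k hD.swap (by linarith)
  exact this.swap

lemma le_of_mul_range (n a m : ℤ) (ha : 0 ≤ a) (hm : m ≠ 0) (h1 : -n ≤ a * m) (h2 : a * m ≤ n) :
    a ≤ n := by
  rcases lt_or_gt_of_ne hm with h | h
  · nlinarith
  · nlinarith

lemma bounds (n1 n2 : ℤ) (Win : ℤ → ℤ → Prop) (c d e f : ℤ) (hc : 0 ≤ c) (hd : 0 ≤ d)
    (he : 0 ≤ e) (hf : 0 ≤ f) (hdet : d * e = c * f + 1) (hF : FF n1 n2 Win (c + e) (d + f))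
    (hD1 : DD n1 n2 Win d (-c)) (hD2 : DD n1 n2 Win (-f) e) : d + f ≤ n1 ∧ c + e ≤ n2 := by
  obtain ⟨x, y, x', y', h1, h2, h3, h4, h5, h6⟩ := hD1
  obtain ⟨X, Y, X', Y', H1, H2, H3, H4, H5, H6⟩ := hD2
  have i1 := hF _ _ ⟨x, y, X', Y', h1, H2, h3, H4, rfl, rfl⟩
  have i2 := hF _ _ ⟨X, Y, x', y', H1, h2, H3, h4, rfl, rfl⟩
  obtain ⟨zx, hzx⟩ : ∃ z, z = x - X := ⟨_, rfl⟩
  obtain ⟨zy, hzy⟩ : ∃ z, z = y - Y := ⟨_, rfl⟩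
  have ex' : x' = x - d := by linarith
  have ey' : y' = y + c := by linarith
  have eX' : X' = X + f := by linarith
  have eY' : Y' = Y - e := by linarith
  have hz : zx * (c + e) + zy * (d + f) = 0 := by
    subst hzx hzy ex' ey' eX' eY'
    apply le_antisymm <;> nlinarith
  obtain ⟨m, hm⟩ : ∃ m, m = -(d * zy + c * zx) := ⟨_, rfl⟩
  have k1 : zx = (d + f) * m := by
    rw [hm]; linear_combination d * hz - zx * hdet
  have k2 : -zy = (c + e) * m := by
    rw [hm]; linear_combination c * hz + zy * hdet
  by_cases m0 : m = 0
  · subst m0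
    constructor <;> omega
  · exact ⟨le_of_mul_range _ _ m (by omega) m0 (by omega) (by omega),
      le_of_mul_range _ _ m (by omega) m0 (by omega) (by omega)⟩

lemma bez (a b : ℕ) (hb : 1 ≤ b) (hab : Nat.Coprime a b) (ha : 1 ≤ a) :
    ∃ c d e f : ℕ, a = c + e ∧ b = d + f ∧ d * e = c * f + 1 := by
  rcases Nat.eq_or_lt_of_le hb with h | h
  · exact ⟨a - 1, 1, 1, 0, by omega, by omega, by simp⟩
  · obtain ⟨d, hd, hd1⟩ := Nat.exists_mul_mod_eq_one_of_coprime hab h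
    have hdm := Nat.div_add_mod (a * d) b
    rw [hd1] at hdm
    have hca : a * d / b ≤ a := by
      apply Nat.div_le_of_le_mul
      nlinarith
    obtain ⟨e, he⟩ := Nat.exists_eq_add_of_le hca
    obtain ⟨f, hf⟩ := Nat.exists_eq_add_of_lt hd
    refine ⟨a * d / b, d, e, f + 1, he, by omega, ?_⟩
    generalize a * d / b = c at *
    subst he hf
    nlinarith

lemma core (n1 n2 : ℕ) (Win : ℤ → ℤ → Prop) (hkl : DD n1 n2 Win 1 (-1))
    (hex : ∃ a b : ℕ, FF n1 n2 Win a b) :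
    ∃ a b : ℕ, FF n1 n2 Win a b ∧ ((a = 1 ∧ b = 0) ∨ ∃ c d e f : ℕ, a = c + e ∧ b = d + f ∧
      d * e = c * f + 1 ∧ DD n1 n2 Win d (-c) ∧ DD n1 n2 Win (-f) e ∧ b ≤ n1 ∧ a ≤ n2) := by
  classical
  have hex' : ∃ s : ℕ, ∃ a b : ℕ, a + b = s ∧ FF n1 n2 Win a b := by
    obtain ⟨a, b, h⟩ := hex
    exact ⟨_, a, b, rfl, h⟩
  obtain ⟨a, b, hs, hF⟩ := Nat.find_spec hex'
  have hmin : ∀ a' b' : ℕ, a' + b' < a + b → ¬ FF n1 n2 Win a' b' := by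
    intro a' b' hlt h
    rw [hs] at hlt
    exact Nat.find_min hex' hlt ⟨a', b', rfl, h⟩
  clear hs
  have hpos : 0 < Nat.gcd a b := by
    rcases Nat.eq_zero_or_pos (Nat.gcd a b) with h | h
    · obtain ⟨rfl, rfl⟩ := Nat.gcd_eq_zero_iff.1 h
      have := hF _ _ hkl
      simp at this
    · exact h
  have hcop : Nat.Coprime a b := by
    by_contra hg
    unfold Nat.Coprime at hg
    obtain ⟨a', ha'⟩ := Nat.gcd_dvd_left a b
    obtain ⟨b', hb'⟩ := Nat.gcd_dvd_right a b
    generalize Nat.gcd a b = g at *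
    have hg2 : 2 ≤ g := by omega
    have hab : 0 < a' + b' := by
      rcases Nat.eq_zero_or_pos (a' + b') with h | h
      · have h1 : a' = 0 := by omega
        have h2 : b' = 0 := by omega
        have := hF _ _ hkl
        rw [ha', hb', h1, h2] at this
        simp at this
      · exact h
    refine hmin a' b' (by nlinarith) ?_
    intro k' l' h'
    have := hF k' l' h'
    rw [ha', hb'] at this
    push_cast at this
    have h3 : (1 : ℤ) ≤ g * (k' * a' + l' * b') := by linarith
    by_contra hcon
    have : (g : ℤ) * (k' * a' + l' * b') ≤ 0 :=
      mul_nonpos_of_nonneg_of_nonpos (by positivity) (by omega)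
    omega
  refine ⟨a, b, hF, ?_⟩
  rcases Nat.eq_zero_or_pos b with hb | hb
  · left
    subst hb
    exact ⟨by simpa using hcop, rfl⟩
  right
  have ha : 1 ≤ a := by
    by_contra h
    have h0 : a = 0 := by omega
    subst h0
    have hb1 : b = 1 := by simpa using hcop
    subst hb1
    have := hF _ _ hkl
    simp at this
  obtain ⟨c, d, e, f, rfl, rfl, hdet⟩ := bez a b hb hcop ha
  have hd0 : 1 ≤ d := by
    rcases Nat.eq_zero_or_pos d with h | h
    · subst h; simp at hdet
    · exact h
  have he0 : 1 ≤ e := by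
    rcases Nat.eq_zero_or_pos e with h | h
    · subst h; simp at hdet
    · exact h
  have m1 := hmin c d (by omega)
  have m2 := hmin e f (by omega)
  unfold FF at m1 m2
  push Not at m1 m2
  obtain ⟨k1, l1, hk1, hk1'⟩ := m1
  obtain ⟨k2, l2, hk2, hk2'⟩ := m2
  push_cast at hF
  have hdet' : (d : ℤ) * e = c * f + 1 := by exact_mod_cast hdet
  have D1 := parent n1 n2 Win c d e f (by positivity) (by positivity) (by positivity) (by positivity)
    hdet' hF k1 l1 hk1 (by omega)
  have D2 := parent' n1 n2 Win c d e f (by positivity) (by positivity) (by positivity) (by positivity)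
    hdet' hF k2 l2 hk2 (by omega)
  have B := bounds n1 n2 Win c d e f (by positivity) (by positivity) (by positivity) (by positivity)
    hdet' hF D1 D2
  exact ⟨c, d, e, f, rfl, rfl, hdet, D1, D2, by exact_mod_cast B.1, by exact_mod_cast B.2⟩

section weights
variable {α : Type*} [DecidableEq α]

lemma exists_top (w : α → ℕ) (s : Finset α) (k : ℕ) (hk : k ≤ s.card) :
    ∃ T ⊆ s, T.card = k ∧ ∀ x ∈ T, ∀ y ∈ s \ T, w y ≤ w x := by
  induction k with
  | zero => exact ⟨∅, by simp, by simp, by simp⟩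
  | succ k ih =>
    obtain ⟨T, hT, hc, h⟩ := ih (by omega)
    have hne : (s \ T).Nonempty := by
      rw [← Finset.card_pos, Finset.card_sdiff_of_subset hT]
      omega
    obtain ⟨m, hm, hmax⟩ := Finset.exists_max_image (s \ T) w hne
    have hm' := Finset.mem_sdiff.1 hm
    refine ⟨insert m T, ?_, ?_, ?_⟩
    · exact Finset.insert_subset hm'.1 hT
    · rw [Finset.card_insert_of_notMem hm'.2, hc]
    · intro x hx y hy
      have hy' : y ∈ s \ T := by
        simp only [Finset.mem_sdiff, Finset.mem_insert, not_or] at hy ⊢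
        tauto
      rcases Finset.mem_insert.1 hx with rfl | hx
      · exact hmax y hy'
      · exact h x hx y hy'

lemma cross (w : α → ℕ) (A B : Finset α) (h : ∀ x ∈ A, ∀ y ∈ B, w y ≤ w x) :
    A.card * ∑ y ∈ B, w y ≤ B.card * ∑ x ∈ A, w x := by
  have : ∑ x ∈ A, ∑ y ∈ B, w y ≤ ∑ x ∈ A, ∑ _y ∈ B, w x :=
    Finset.sum_le_sum fun x hx => Finset.sum_le_sum fun y hy => h x hx y hy
  simpa [Finset.mul_sum] using this

lemma exists_big (w : α → ℕ) (s : Finset α) (k : ℕ) (hk : k ≤ s.card) :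
    ∃ T ⊆ s, T.card = k ∧ k * ∑ x ∈ s, w x ≤ s.card * ∑ x ∈ T, w x := by
  obtain ⟨T, hT, hc, h⟩ := exists_top w s k hk
  refine ⟨T, hT, hc, ?_⟩
  have := cross w T (s \ T) h
  have h1 := Finset.sum_sdiff (f := w) hT
  have h2 := Finset.card_sdiff_add_card_eq_card hT
  rw [← h1, ← h2, ← hc]
  nlinarith

lemma exists_small (w : α → ℕ) (s : Finset α) (k : ℕ) (hk : k ≤ s.card) :
    ∃ T ⊆ s, T.card = k ∧ s.card * ∑ x ∈ T, w x ≤ k * ∑ x ∈ s, w x := by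
  obtain ⟨T, hT, hc, h⟩ := exists_big w s (s.card - k) (by omega)
  have h1 := Finset.sum_sdiff (f := w) hT
  have h2 := Finset.card_sdiff_add_card_eq_card hT
  have h3 : (s \ T).card = k := by omega
  refine ⟨s \ T, Finset.sdiff_subset, h3, ?_⟩
  rw [hc] at h2
  generalize s.card - k = j at *
  rw [h3] at h2
  rw [← h1, ← h2] at h ⊢
  nlinarith

lemma lemX (w : α → ℕ) (N1 N2 : Finset α) (c d e f : ℕ) (hdet : d * e = c * f + 1)
    (hb : d + f ≤ N1.card) (ha : c + e ≤ N2.card)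
    (H1 : ∀ S ⊆ N1, ∀ T ⊆ N2, S.card = d → T.card = c → ∑ x ∈ T, w x + 1 ≤ ∑ x ∈ S, w x)
    (H2 : ∀ S ⊆ N1, ∀ T ⊆ N2, S.card = f → T.card = e → ∑ x ∈ S, w x + 1 ≤ ∑ x ∈ T, w x) :
    ∀ i ∈ N1, c + e ≤ w i := by
  have hd0 : 1 ≤ d := by
    rcases Nat.eq_zero_or_pos d with h | h
    · subst h; simp at hdet
    · exact h
  have he0 : 1 ≤ e := by
    rcases Nat.eq_zero_or_pos e with h | h
    · subst h; simp at hdet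
    · exact h
  intro i0 hi0
  obtain ⟨i, hi, himin⟩ := Finset.exists_min_image N1 w ⟨i0, hi0⟩
  refine le_trans ?_ (himin i0 hi0)
  have hce := Finset.card_erase_of_mem hi
  -- the heaviest `f` voters
  obtain ⟨S', hS', hS'c, hS't⟩ := exists_top w (N1.erase i) f (by omega)
  have hrest : ((N1.erase i) \ S').card = N1.card - 1 - f := by
    rw [Finset.card_sdiff_of_subset hS', hce, hS'c]
  obtain ⟨S0, hS0, hS0c⟩ := Finset.exists_subset_card_eq (s := (N1.erase i) \ S') (n := d - 1) (by omega)
  have hiS0 : i ∉ S0 := fun h => by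
    have := hS0 h
    simp at this
  have hS0' : S0 ⊆ N1.erase i := hS0.trans Finset.sdiff_subset
  -- the second class
  obtain ⟨T, hT, hTc, hTt⟩ := exists_top w N2 c (by omega)
  obtain ⟨T', hT', hT'c⟩ := Finset.exists_subset_card_eq (s := N2 \ T) (n := e) (by
    rw [Finset.card_sdiff_of_subset hT]; omega)
  have r1 := H1 (insert i S0) (Finset.insert_subset hi (hS0'.trans (Finset.erase_subset _ _))) T hT
    (by rw [Finset.card_insert_of_notMem hiS0]; omega) hTc
  have r2 := H2 S' (hS'.trans (Finset.erase_subset _ _)) T' (hT'.trans Finset.sdiff_subset) hS'c hT'c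
  have r3 := cross w T T' (fun x hx y hy => hTt x hx y (hT' hy))
  rw [hTc, hT'c] at r3
  rw [Finset.sum_insert hiS0] at r1
  obtain ⟨m, hm1, hm2, hm3⟩ : ∃ m, w i ≤ m ∧ (∀ x ∈ S0, w x ≤ m) ∧ (∀ x ∈ S', m ≤ w x) := by
    rcases S0.eq_empty_or_nonempty with h | h
    · exact ⟨w i, le_rfl, by simp [h], fun x hx => himin x (Finset.mem_of_mem_erase (hS' hx))⟩
    · obtain ⟨x0, hx0, hmax⟩ := Finset.exists_max_image S0 w h
      exact ⟨w x0, himin x0 (Finset.mem_of_mem_erase (hS0' hx0)), hmax,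
        fun x hx => hS't x hx x0 (hS0 hx0)⟩
  have r4 : ∑ x ∈ S0, w x ≤ (d - 1) * m := by
    have := Finset.sum_le_card_nsmul S0 w m hm2
    simpa [hS0c] using this
  have r5 : f * m ≤ ∑ x ∈ S', w x := by
    have := Finset.card_nsmul_le_sum S' w m hm3
    simpa [hS'c] using this
  obtain ⟨d', rfl⟩ : ∃ d', d = d' + 1 := ⟨d - 1, by omega⟩
  obtain ⟨e', rfl⟩ : ∃ e', e = e' + 1 := ⟨e - 1, by omega⟩
  simp only [Nat.add_sub_cancel] at r4
  have q1 := Nat.mul_le_mul_left (e' + 1) r1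
  have q2 := Nat.mul_le_mul_left c r2
  have q4 := Nat.mul_le_mul_left (e' + 1) r4
  have q5 := Nat.mul_le_mul_left c r5
  have q6 := Nat.mul_le_mul_left e' hm1
  have q7 : (d' + 1) * (e' + 1) * m = (c * f + 1) * m := by rw [hdet]
  nlinarith

end weights

section game
variable {n : ℕ} {χ : Finset (Fin n) → Prop} {N1 N2 : Finset (Fin n)}

lemma TwoTypes.part (h2 : TwoTypes χ N1 N2) (i : Fin n) : i ∈ N1 ∨ i ∈ N2 := by
  have : i ∈ N1 ∪ N2 := by rw [h2.2.2.2.1]; simp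
  simpa using this

lemma sdiff_split (h2 : TwoTypes χ N1 N2) (S : Finset (Fin n)) :
    S = (S ∩ N1) ∪ (S ∩ N2) := by
  rw [← Finset.inter_union_distrib_left, h2.2.2.2.1, Finset.inter_univ]

lemma sum_split (h2 : TwoTypes χ N1 N2) (S : Finset (Fin n)) (w : Fin n → ℕ) :
    ∑ i ∈ S, w i = ∑ i ∈ S ∩ N1, w i + ∑ i ∈ S ∩ N2, w i := by
  conv_lhs => rw [sdiff_split h2 S]
  apply Finset.sum_union
  exact Finset.disjoint_of_subset_left Finset.inter_subset_right
    (Finset.disjoint_of_subset_right Finset.inter_subset_right h2.2.2.1)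

lemma exch_aux (N U V : Finset (Fin n)) (hc : (U ∩ N).card = (V ∩ N).card) (i : Fin n)
    (hi : i ∈ U) (hiV : i ∉ V) (hiN : i ∈ N) : ∃ j, j ∈ V ∧ j ∉ U ∧ j ∈ N := by
  by_contra hcon
  push Not at hcon
  have hss : V ∩ N ⊂ U ∩ N := by
    rw [Finset.ssubset_iff_of_subset]
    · exact ⟨i, by simp [hi, hiN], by simp [hiV]⟩
    · intro j hj
      simp only [Finset.mem_inter] at hj ⊢
      refine ⟨?_, hj.2⟩
      by_contra hjU
      exact hcon j hj.1 hjU hj.2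
  have := Finset.card_lt_card hss
  omega

lemma card_swap (N U : Finset (Fin n)) (i j : Fin n) (hi : i ∈ U) (hj : j ∉ U)
    (hN : i ∈ N ↔ j ∈ N) : ((insert j (U.erase i)) ∩ N).card = (U ∩ N).card := by
  by_cases h : j ∈ N
  · have hiN := hN.2 h
    rw [Finset.insert_inter_of_mem h, Finset.card_insert_of_notMem (by simp [hj]),
      Finset.erase_inter, Finset.card_erase_of_mem (by simp [hi, hiN])]
    have : 0 < (U ∩ N).card := Finset.card_pos.2 ⟨i, by simp [hi, hiN]⟩
    omega
  · have hiN : i ∉ N := fun h' => h (hN.1 h')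
    rw [Finset.insert_inter_of_notMem h, Finset.erase_inter, Finset.erase_eq_of_notMem (by simp [hiN])]

lemma invar (hsg : SimpleGame n χ) (h2 : TwoTypes χ N1 N2) : ∀ (m : ℕ) (U V : Finset (Fin n)),
    (U \ V).card = m → (U ∩ N1).card = (V ∩ N1).card → (U ∩ N2).card = (V ∩ N2).card →
    χ U → χ V := by
  intro m
  induction m with
  | zero =>
    intro U V h _ _ hU
    have : U ⊆ V := by
      rw [Finset.card_eq_zero, Finset.sdiff_eq_empty_iff_subset] at h
      exact h
    exact hsg.1 U V this hU
  | succ m ih =>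
    intro U V h c1 c2 hU
    obtain ⟨i, hi⟩ : (U \ V).Nonempty := by
      rw [← Finset.card_pos]; omega
    obtain ⟨hiU, hiV⟩ := Finset.mem_sdiff.1 hi
    have hdis := Finset.disjoint_left.1 h2.2.2.1
    obtain ⟨j, hjV, hjU, hd, e1, e2⟩ : ∃ j, j ∈ V ∧ j ∉ U ∧ Desir χ j i ∧ (i ∈ N1 ↔ j ∈ N1) ∧
        (i ∈ N2 ↔ j ∈ N2) := by
      rcases h2.part i with hN | hN
      · obtain ⟨j, a, b, c⟩ := exch_aux N1 U V c1 i hiU hiV hN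
        have := hdis hN
        have := hdis c
        exact ⟨j, a, b, (h2.2.2.2.2.1 j c i hN).1, by tauto, by tauto⟩
      · obtain ⟨j, a, b, c⟩ := exch_aux N2 U V c2 i hiU hiV hN
        have h3 : i ∉ N1 := fun h => hdis h hN
        have h4 : j ∉ N1 := fun h => hdis h c
        exact ⟨j, a, b, (h2.2.2.2.2.2.1 j c i hN).1, by tauto, by tauto⟩
    have hU' := hd U hiU hjU hU
    refine ih (insert j (U.erase i)) V ?_ ?_ ?_ hU'
    · rw [Finset.insert_sdiff_of_mem _ hjV, ← show (U \ V).erase i = (U.erase i) \ V from by ext x; simp; tauto,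
        Finset.card_erase_of_mem hi, h]
      rfl
    · rw [card_swap N1 U i j hiU hjU e1, c1]
    · rw [card_swap N2 U i j hiU hjU e2, c2]

end game

section game2
variable {n : ℕ} {χ : Finset (Fin n) → Prop} {N1 N2 : Finset (Fin n)}

def WinZ (χ : Finset (Fin n) → Prop) (N1 N2 : Finset (Fin n)) (x y : ℤ) : Prop :=
  ∃ U, χ U ∧ ((U ∩ N1).card : ℤ) = x ∧ ((U ∩ N2).card : ℤ) = y

lemma union_inter_left' (h2 : TwoTypes χ N1 N2) {A B : Finset (Fin n)} (hA : A ⊆ N1) (hB : B ⊆ N2) :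
    (A ∪ B) ∩ N1 = A ∧ (A ∪ B) ∩ N2 = B := by
  have hd := Finset.disjoint_left.1 h2.2.2.1
  constructor
  · ext x
    simp only [Finset.mem_inter, Finset.mem_union]
    constructor
    · rintro ⟨h | h, h'⟩
      · exact h
      · exact absurd (hB h) (hd h')
    · intro h
      exact ⟨Or.inl h, hA h⟩
  · ext x
    simp only [Finset.mem_inter, Finset.mem_union]
    constructor
    · rintro ⟨h | h, h'⟩
      · exact absurd h' (hd (hA h))
      · exact h
    · intro h
      exact ⟨Or.inr h, hB h⟩

lemma sum_union' (h2 : TwoTypes χ N1 N2) {A B : Finset (Fin n)} (hA : A ⊆ N1) (hB : B ⊆ N2)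
    (w : Fin n → ℕ) : ∑ i ∈ A ∪ B, w i = ∑ i ∈ A, w i + ∑ i ∈ B, w i :=
  Finset.sum_union (Finset.disjoint_of_subset_left hA (Finset.disjoint_of_subset_right hB h2.2.2.1))

lemma inter_le (U N : Finset (Fin n)) : (U ∩ N).card ≤ N.card :=
  Finset.card_le_card Finset.inter_subset_right

lemma DD_of (hsg : SimpleGame n χ) (h2 : TwoTypes χ N1 N2) (P R : Finset (Fin n)) (hP : χ P)
    (hR : ¬ χ R) : DD N1.card N2.card (WinZ χ N1 N2)
      (((P ∩ N1).card : ℤ) - (R ∩ N1).card) (((P ∩ N2).card : ℤ) - (R ∩ N2).card) := by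
  refine ⟨_, _, _, _, ⟨by positivity, ?_, by positivity, ?_⟩, ⟨by positivity, ?_, by positivity, ?_⟩,
    ⟨P, hP, rfl, rfl⟩, ?_, rfl, rfl⟩
  · exact_mod_cast inter_le P N1
  · exact_mod_cast inter_le P N2
  · exact_mod_cast inter_le R N1
  · exact_mod_cast inter_le R N2
  · rintro ⟨U, hU, h, h'⟩
    exact hR (invar hsg h2 _ U R rfl (by exact_mod_cast h) (by exact_mod_cast h') hU)

lemma DD_use (hsg : SimpleGame n χ) (h2 : TwoTypes χ N1 N2) (k l : ℤ)
    (h : DD N1.card N2.card (WinZ χ N1 N2) k l) :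
    ∃ x y x' y' : ℕ, x ≤ N1.card ∧ y ≤ N2.card ∧ x' ≤ N1.card ∧ y' ≤ N2.card ∧
      k = x - x' ∧ l = y - y' ∧
      (∀ A ⊆ N1, ∀ B ⊆ N2, A.card = x → B.card = y → χ (A ∪ B)) ∧
      (∀ A ⊆ N1, ∀ B ⊆ N2, A.card = x' → B.card = y' → ¬ χ (A ∪ B)) := by
  obtain ⟨x, y, x', y', b1, b2, hw, hl, hk, hl'⟩ := h
  lift x to ℕ using b1.1
  lift y to ℕ using b1.2.2.1
  lift x' to ℕ using b2.1
  lift y' to ℕ using b2.2.2.1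
  refine ⟨x, y, x', y', by exact_mod_cast b1.2.1, by exact_mod_cast b1.2.2.2,
    by exact_mod_cast b2.2.1, by exact_mod_cast b2.2.2.2, hk, hl', ?_, ?_⟩
  · intro A hA B hB hAc hBc
    obtain ⟨U, hU, e1, e2⟩ := hw
    obtain ⟨i1, i2⟩ := union_inter_left' h2 hA hB
    refine invar hsg h2 _ U _ rfl ?_ ?_ hU
    · rw [i1, hAc]; exact_mod_cast e1
    · rw [i2, hBc]; exact_mod_cast e2
  · intro A hA B hB hAc hBc hχ
    obtain ⟨i1, i2⟩ := union_inter_left' h2 hA hB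
    exact hl ⟨_, hχ, by rw [i1, hAc], by rw [i2, hBc]⟩

/-- Weights of a difference, first sign pattern. -/
lemma diff1 (hsg : SimpleGame n χ) (h2 : TwoTypes χ N1 N2) (q : ℕ) (w : Fin n → ℕ)
    (hr : IsRep χ q w) (k l : ℕ) (h : DD N1.card N2.card (WinZ χ N1 N2) k (-l)) :
    ∀ S ⊆ N1, ∀ T ⊆ N2, S.card = k → T.card = l → ∑ x ∈ T, w x + 1 ≤ ∑ x ∈ S, w x := by
  intro S hS T hT hSc hTc
  obtain ⟨x, y, x', y', b1, b2, b3, b4, hk, hl, hw, hlo⟩ := DD_use hsg h2 _ _ h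
  obtain ⟨X, hX, hXc⟩ := Finset.exists_subset_card_eq (s := N1 \ S) (n := x') (by
    rw [Finset.card_sdiff_of_subset hS]; omega)
  obtain ⟨Y, hY, hYc⟩ := Finset.exists_subset_card_eq (s := N2 \ T) (n := y) (by
    rw [Finset.card_sdiff_of_subset hT]; omega)
  have dX : Disjoint X S := Finset.disjoint_of_subset_left hX Finset.sdiff_disjoint
  have dY : Disjoint Y T := Finset.disjoint_of_subset_left hY Finset.sdiff_disjoint
  have hX' := hX.trans Finset.sdiff_subset
  have hY' := hY.trans Finset.sdiff_subset
  have g1 := hw (X ∪ S) (Finset.union_subset hX' hS) Y hY'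
    (by rw [Finset.card_union_of_disjoint dX]; omega) hYc
  have g2 := hlo X hX' (Y ∪ T) (Finset.union_subset hY' hT) hXc
    (by rw [Finset.card_union_of_disjoint dY]; omega)
  rw [hr, sum_union' h2 (Finset.union_subset hX' hS) hY', Finset.sum_union dX] at g1
  rw [hr, sum_union' h2 hX' (Finset.union_subset hY' hT), Finset.sum_union dY] at g2
  omega

lemma diff2 (hsg : SimpleGame n χ) (h2 : TwoTypes χ N1 N2) (q : ℕ) (w : Fin n → ℕ)
    (hr : IsRep χ q w) (k l : ℕ) (h : DD N1.card N2.card (WinZ χ N1 N2) (-k) l) :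
    ∀ S ⊆ N1, ∀ T ⊆ N2, S.card = k → T.card = l → ∑ x ∈ S, w x + 1 ≤ ∑ x ∈ T, w x := by
  intro S hS T hT hSc hTc
  obtain ⟨x, y, x', y', b1, b2, b3, b4, hk, hl, hw, hlo⟩ := DD_use hsg h2 _ _ h
  obtain ⟨X, hX, hXc⟩ := Finset.exists_subset_card_eq (s := N1 \ S) (n := x) (by
    rw [Finset.card_sdiff_of_subset hS]; omega)
  obtain ⟨Y, hY, hYc⟩ := Finset.exists_subset_card_eq (s := N2 \ T) (n := y') (by
    rw [Finset.card_sdiff_of_subset hT]; omega)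
  have dX : Disjoint X S := Finset.disjoint_of_subset_left hX Finset.sdiff_disjoint
  have dY : Disjoint Y T := Finset.disjoint_of_subset_left hY Finset.sdiff_disjoint
  have hX' := hX.trans Finset.sdiff_subset
  have hY' := hY.trans Finset.sdiff_subset
  have g1 := hw X hX' (Y ∪ T) (Finset.union_subset hY' hT) hXc
    (by rw [Finset.card_union_of_disjoint dY]; omega)
  have g2 := hlo (X ∪ S) (Finset.union_subset hX' hS) Y hY'
    (by rw [Finset.card_union_of_disjoint dX]; omega) hYc
  rw [hr, sum_union' h2 hX' (Finset.union_subset hY' hT), Finset.sum_union dY] at g1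
  rw [hr, sum_union' h2 (Finset.union_subset hX' hS) hY', Finset.sum_union dX] at g2
  omega

lemma feas (hsg : SimpleGame n χ) (h2 : TwoTypes χ N1 N2) (hwt : IsWeighted χ) :
    ∃ a b : ℕ, FF N1.card N2.card (WinZ χ N1 N2) a b := by
  obtain ⟨q, w, hr⟩ := hwt
  refine ⟨N2.card * ∑ i ∈ N1, w i, N1.card * ∑ i ∈ N2, w i, ?_⟩
  intro k l h
  obtain ⟨x, y, x', y', b1, b2, b3, b4, hk, hl, hw, hlo⟩ := DD_use hsg h2 _ _ h
  obtain ⟨A, hA, hAc, hAs⟩ := exists_small w N1 x b1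
  obtain ⟨B, hB, hBc, hBs⟩ := exists_small w N2 y b2
  obtain ⟨A', hA', hAc', hAs'⟩ := exists_big w N1 x' b3
  obtain ⟨B', hB', hBc', hBs'⟩ := exists_big w N2 y' b4
  have g1 := hw A hA B hB hAc hBc
  have g2 := hlo A' hA' B' hB' hAc' hBc'
  rw [hr, sum_union' h2 hA hB] at g1
  rw [hr, sum_union' h2 hA' hB'] at g2
  have p1 := Finset.card_pos.2 h2.1
  have p2 := Finset.card_pos.2 h2.2.1
  have g3 : ∑ i ∈ A', w i + ∑ i ∈ B', w i + 1 ≤ ∑ i ∈ A, w i + ∑ i ∈ B, w i := by omega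
  subst hk hl
  generalize ∑ i ∈ A', w i = sA' at *
  generalize ∑ i ∈ B', w i = sB' at *
  generalize ∑ i ∈ A, w i = sA at *
  generalize ∑ i ∈ B, w i = sB at *
  generalize ∑ i ∈ N1, w i = s1 at *
  generalize ∑ i ∈ N2, w i = s2 at *
  generalize N1.card = n1 at *
  generalize N2.card = n2 at *
  have k1 := Nat.mul_le_mul_left n2 hAs
  have k2 := Nat.mul_le_mul_left n1 hBs
  have k3 := Nat.mul_le_mul_left n2 hAs'
  have k4 := Nat.mul_le_mul_left n1 hBs'
  have k5 := Nat.mul_le_mul_left (n1 * n2) g3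
  have k6 : 1 ≤ n1 * n2 := Nat.mul_pos p1 p2
  have k7 : x' * (n2 * s1) + y' * (n1 * s2) + 1 ≤ x * (n2 * s1) + y * (n1 * s2) := by nlinarith
  zify at k7
  push_cast
  linarith

lemma DD_strict (hsg : SimpleGame n χ) (h2 : TwoTypes χ N1 N2) :
    DD N1.card N2.card (WinZ χ N1 N2) 1 (-1) := by
  obtain ⟨i, hi⟩ := h2.1
  obtain ⟨j, hj⟩ := h2.2.1
  have hd := Finset.disjoint_left.1 h2.2.2.1
  have hs := (h2.2.2.2.2.2.2 i hi j hj).2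
  unfold Desir at hs
  push Not at hs
  obtain ⟨U, hiU, hjU, hU, hV⟩ := hs
  have hi2 : i ∉ N2 := hd hi
  have hj1 : j ∉ N1 := fun h => hd h hj
  have := DD_of hsg h2 U _ hU hV
  rw [Finset.insert_inter_of_notMem hj1, Finset.insert_inter_of_mem hj,
    Finset.card_insert_of_notMem (by simp [hjU]), Finset.erase_inter, Finset.erase_inter,
    Finset.card_erase_of_mem (by simp [hi, hiU]), Finset.erase_eq_of_notMem (by simp [hi2])] at this
  have hp : 0 < (U ∩ N1).card := Finset.card_pos.2 ⟨i, by simp [hi, hiU]⟩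
  convert this using 1 <;> omega

lemma rep_of (hsg : SimpleGame n χ) (h2 : TwoTypes χ N1 N2) (a b : ℕ)
    (hF : FF N1.card N2.card (WinZ χ N1 N2) a b) :
    ∃ q, IsRep χ q (fun i => if i ∈ N1 then a else b) := by
  classical
  let g : Finset (Fin n) → ℕ := fun U => ∑ i ∈ U, if i ∈ N1 then a else b
  have hg : ∀ U, g U = (U ∩ N1).card * a + (U ∩ N2).card * b := by
    intro U
    have hd := Finset.disjoint_left.1 h2.2.2.1
    change ∑ i ∈ U, (if i ∈ N1 then a else b) = _
    rw [sum_split h2]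
    congr 1
    · rw [Finset.sum_congr rfl (g := fun _ => a)]
      · simp
      · intro x hx
        simp [(Finset.mem_inter.1 hx).2]
    · rw [Finset.sum_congr rfl (g := fun _ => b)]
      · simp
      · intro x hx
        have : x ∉ N1 := fun h => hd h (Finset.mem_inter.1 hx).2
        simp [this]
  have key : ∀ P R, χ P → ¬ χ R → g R < g P := by
    intro P R hP hR
    have := hF _ _ (DD_of hsg h2 P R hP hR)
    rw [hg, hg]
    zify
    linarith
  refine ⟨(Finset.univ.filter fun U => ¬ χ U).sup g + 1, ?_⟩
  intro U
  change _ ↔ _ ≤ g U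
  constructor
  · intro hU
    rw [Nat.succ_le_iff, Finset.sup_lt_iff]
    · intro R hR
      exact key U R hU (by simpa using hR)
    · exact lt_of_le_of_lt (Nat.zero_le _) (key U ∅ hU hsg.2.1)
  · intro h
    by_contra hU
    have : g U ≤ (Finset.univ.filter fun U => ¬ χ U).sup g :=
      Finset.le_sup (f := g) (by simp [hU])
    omega

end game2

theorem stmt0 (n : ℕ) (χ : Finset (Fin n) → Prop) (hsg : SimpleGame n χ)
    (hwt : IsWeighted χ) (N1 N2 : Finset (Fin n)) (h2 : TwoTypes χ N1 N2) :
    ∃ (q : ℕ) (w : Fin n → ℕ), MinRep χ q w ∧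
      (∀ i ∈ N1, ∀ j ∈ N1, w i = w j) ∧
      (∀ i ∈ N2, ∀ j ∈ N2, w i = w j) ∧
      (∀ i ∈ N1, w i ≤ max (N1.card + 1) N2.card) ∧
      (∀ i ∈ N2, w i ≤ max N1.card (N2.card - 1)) ∧
      q ≤ (N1.card + N2.card) * max (N1.card + 1) N2.card := by
  classical
  obtain ⟨a, b, hF, hab⟩ := core N1.card N2.card (WinZ χ N1 N2) (DD_strict hsg h2)
    (feas hsg h2 hwt)
  obtain ⟨q, hq⟩ := rep_of hsg h2 a b hF
  have hd := Finset.disjoint_left.1 h2.2.2.1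
  have w1 : ∀ i ∈ N1, (if i ∈ N1 then a else b) = a := fun i hi => by simp [hi]
  have w2 : ∀ i ∈ N2, (if i ∈ N1 then a else b) = b := fun i hi => by
    have : i ∉ N1 := fun h => hd h hi
    simp [this]
  have p1 := Finset.card_pos.2 h2.1
  have ba : a ≤ max (N1.card + 1) N2.card := by
    rcases hab with ⟨rfl, rfl⟩ | ⟨c, d, e, f, -, -, -, -, -, -, h⟩ <;> omega
  have bb : b ≤ max N1.card (N2.card - 1) := by
    rcases hab with ⟨rfl, rfl⟩ | ⟨c, d, e, f, -, -, -, -, -, h, -⟩ <;> omega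
  have bb' : b ≤ max (N1.card + 1) N2.card := by omega
  refine ⟨q, fun i => if i ∈ N1 then a else b, ⟨hq, ?_⟩, ?_, ?_, ?_, ?_, ?_⟩
  · intro q' w' hr i
    have D0 := diff1 hsg h2 q' w' hr 1 1 (by exact_mod_cast DD_strict hsg h2)
    have hmin : (∀ i ∈ N1, a ≤ w' i) ∧ (∀ i ∈ N2, b ≤ w' i) := by
      rcases hab with ⟨rfl, rfl⟩ | ⟨c, d, e, f, rfl, rfl, hdet, D1, D2, hb, ha⟩
      · refine ⟨fun i hi => ?_, fun _ _ => Nat.zero_le _⟩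
        obtain ⟨j, hj⟩ := h2.2.1
        have := D0 {i} (by simpa using hi) {j} (by simpa using hj) (by simp) (by simp)
        simp at this
        omega
      · have H1 := diff1 hsg h2 q' w' hr d c D1
        have H2 := diff2 hsg h2 q' w' hr f e D2
        refine ⟨lemX w' N1 N2 c d e f hdet hb ha H1 H2, ?_⟩
        intro i hi
        have := lemX w' N2 N1 f e d c (by linarith) (by omega) (by omega)
          (fun S hS T hT h h' => H2 T hT S hS h' h) (fun S hS T hT h h' => H1 T hT S hS h' h) i hi
        omega
    rcases h2.part i with hi | hi
    · simpa only [w1 i hi] using hmin.1 i hi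
    · simpa only [w2 i hi] using hmin.2 i hi
  · intro i hi j hj
    simp only [w1 i hi, w1 j hj]
  · intro i hi j hj
    simp only [w2 i hi, w2 j hj]
  · intro i hi
    simpa only [w1 i hi] using ba
  · intro i hi
    simpa only [w2 i hi] using bb
  · have h := (hq Finset.univ).1 hsg.2.2
    refine h.trans ?_
    have hc : N1.card + N2.card = (Finset.univ : Finset (Fin n)).card := by
      rw [← h2.2.2.2.1, Finset.card_union_of_disjoint h2.2.2.1]
    rw [hc]
    have := Finset.sum_le_card_nsmul (Finset.univ : Finset (Fin n))
      (fun i => if i ∈ N1 then a else b) (max (N1.card + 1) N2.card) (by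
        intro i _
        split_ifs
        · exact ba
        · exact bb')
    simpa using this
end

section
/- Let χ be a weighted game on n voters with exactly two types of voters, without null voters, and with at least two distinct types of shift-minimal winning coalitions (r ≥ 2). Suppose (a, b) and (c, d) with a > c are types of shift-minimal winning coalitions of χ, (e, f) is the type of a shift-maximal losing coalition of χ, the determinant f·c − f·a + a·d − b·c − e·d + e·b is nonzero, and (w1, w2, q) is an LP-feasible triple of nonnegative reals satisfying a·w1 + b·w2 = q, c·w1 + d·w2 = q and e·w1 + f·w2 = q − 1. Then w1, w2 and q are nonnegative integers, and every LP-feasible triple (w1', w2', q') satisfies w1' ≥ w1, w2' ≥ w2 and q' ≥ q. -/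
/-- Weight of a coalition when members of `N1` weigh `w1` and all others `w2`. -/
noncomputable def levW {n : ℕ} (N1 : Finset (Fin n)) (w1 w2 : ℝ) (U : Finset (Fin n)) : ℝ :=
  ∑ i ∈ U, (if i ∈ N1 then w1 else w2)

theorem levW_eq {n : ℕ} {χ : Finset (Fin n) → Prop} {N1 N2 : Finset (Fin n)}
    (h2 : TwoTypes χ N1 N2) (w1 w2 : ℝ) (U : Finset (Fin n)) :
    levW N1 w1 w2 U = ((U ∩ N1).card : ℝ) * w1 + ((U ∩ N2).card : ℝ) * w2 := by
  obtain ⟨-, -, hd, hu, -⟩ := h2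
  have hmem : ∀ i : Fin n, i ∈ N1 ∨ i ∈ N2 := fun i => by
    have : i ∈ N1 ∪ N2 := by rw [hu]; exact Finset.mem_univ i
    simpa using this
  have h1 : U.filter (fun i => i ∈ N1) = U ∩ N1 := by ext i; simp
  have h3 : U.filter (fun i => ¬ i ∈ N1) = U ∩ N2 := by
    ext i
    have := hmem i
    have h' : i ∈ N1 → i ∉ N2 := fun h => Finset.disjoint_left.mp hd h
    simp only [Finset.mem_filter, Finset.mem_inter]
    tauto
  unfold levW
  rw [Finset.sum_ite, h1, h3]
  simp

theorem levW_insert {n : ℕ} (N1 : Finset (Fin n)) (w1 w2 : ℝ) {U : Finset (Fin n)} {j : Fin n}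
    (h : j ∉ U) : levW N1 w1 w2 (insert j U) = (if j ∈ N1 then w1 else w2) + levW N1 w1 w2 U := by
  unfold levW
  rw [Finset.sum_insert h]

theorem levW_erase {n : ℕ} (N1 : Finset (Fin n)) (w1 w2 : ℝ) {U : Finset (Fin n)} {j : Fin n}
    (h : j ∈ U) : levW N1 w1 w2 (U.erase j) = levW N1 w1 w2 U - (if j ∈ N1 then w1 else w2) := by
  unfold levW
  rw [← Finset.add_sum_erase U _ h]
  ring

theorem strict_types {n : ℕ} {χ : Finset (Fin n) → Prop} {N1 N2 : Finset (Fin n)}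
    (h2 : TwoTypes χ N1 N2) {i j : Fin n} (h : StrictDesir χ i j) : i ∈ N1 ∧ j ∉ N1 := by
  obtain ⟨-, -, hd, hu, e1, e2, e3⟩ := h2
  have hmem : ∀ i : Fin n, i ∈ N1 ∨ i ∈ N2 := fun i => by
    have : i ∈ N1 ∪ N2 := by rw [hu]; exact Finset.mem_univ i
    simpa using this
  have hj : i ∈ N2 → j ∈ N2 → False := fun a b => h.2 (e2 i a j b).2
  have hj1 : i ∈ N1 → j ∈ N1 → False := fun a b => h.2 (e1 i a j b).2
  have hj2 : i ∈ N2 → j ∈ N1 → False := fun a b => h.2 (e3 j b i a).1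
  have := hmem i
  have := hmem j
  tauto

/-- With `0 < w2 < w1`, the weight separates winning from losing coalitions. -/
theorem lev_sep {n : ℕ} {χ : Finset (Fin n) → Prop} {N1 N2 : Finset (Fin n)}
    (h2 : TwoTypes χ N1 N2) {w1 w2 q : ℝ} (hf : LPFeasible χ N1 N2 w1 w2 q)
    (hw2 : 0 < w2) (hw : w2 < w1) :
    (∀ U, χ U → q ≤ levW N1 w1 w2 U) ∧ (∀ U, ¬ χ U → levW N1 w1 w2 U ≤ q - 1) := by
  classical
  obtain ⟨-, -, -, hwin, hlose⟩ := hf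
  have pos : ∀ j : Fin n, 0 < (if j ∈ N1 then w1 else w2) := fun j => by
    split_ifs <;> linarith
  constructor
  · intro U hU
    obtain ⟨V, hV, hmin⟩ := Finset.exists_min_image
      (Finset.univ.filter (fun U : Finset (Fin n) => χ U)) (levW N1 w1 w2) ⟨U, by simpa using hU⟩
    simp only [Finset.mem_filter, Finset.mem_univ, true_and] at hV hmin
    have hs : ShiftMinWin χ V := by
      refine ⟨hV, fun i hi hc => ?_, fun i hi j hj hij hc => ?_⟩
      · have := hmin _ hc
        rw [levW_erase _ _ _ hi] at this
        linarith [pos i]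
      · have := hmin _ hc
        have hij' := strict_types h2 hij
        rw [levW_insert _ _ _ (by simp [hj]), levW_erase _ _ _ hi, if_pos hij'.1,
          if_neg hij'.2] at this
        linarith
    have := hwin V hs
    rw [← levW_eq h2] at this
    exact this.trans (hmin U hU)
  · intro U hU
    obtain ⟨V, hV, hmax⟩ := Finset.exists_max_image
      (Finset.univ.filter (fun U : Finset (Fin n) => ¬ χ U)) (levW N1 w1 w2)
      ⟨U, by simpa using hU⟩
    simp only [Finset.mem_filter, Finset.mem_univ, true_and] at hV hmax
    have hs : ShiftMaxLose χ V := by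
      refine ⟨hV, fun j hj => ?_, fun j hj i hi hij => ?_⟩
      · by_contra hc
        have := hmax _ hc
        rw [levW_insert _ _ _ hj] at this
        linarith [pos j]
      · by_contra hc
        have := hmax _ hc
        have hij' := strict_types h2 hij
        rw [levW_insert _ _ _ (by simp [hi]), levW_erase _ _ _ hj, if_pos hij'.1,
          if_neg hij'.2] at this
        linarith
    have := hlose V hs
    rw [← levW_eq h2] at this
    exact (hmax U hU).trans this

theorem desir_of_mem {n : ℕ} {χ : Finset (Fin n) → Prop} {N1 N2 : Finset (Fin n)}
    (h2 : TwoTypes χ N1 N2) {i j : Fin n} (h : j ∈ N1 → i ∈ N1) : Desir χ i j := by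
  obtain ⟨-, -, hd, hu, e1, e2, e3⟩ := h2
  have hmem : ∀ i : Fin n, i ∈ N1 ∨ i ∈ N2 := fun i => by
    have : i ∈ N1 ∪ N2 := by rw [hu]; exact Finset.mem_univ i
    simpa using this
  by_cases hj : j ∈ N1
  · exact (e1 i (h hj) j hj).1
  · have hj2 := (hmem j).resolve_left hj
    rcases hmem i with hi | hi
    · exact (e3 i hi j hj2).1
    · exact (e2 i hi j hj2).1

/-- Dominance of types transfers winning. -/
theorem dom_win {n : ℕ} {χ : Finset (Fin n) → Prop} {N1 N2 : Finset (Fin n)}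
    (hsg : SimpleGame n χ) (h2 : TwoTypes χ N1 N2) (U : Finset (Fin n)) :
    ∀ (k : ℕ) (V : Finset (Fin n)), (V \ U).card = k → χ V →
      (V ∩ N1).card ≤ (U ∩ N1).card → V.card ≤ U.card → χ U := by
  classical
  intro k
  induction k with
  | zero =>
    intro V hk hV _ _
    have : V \ U = ∅ := Finset.card_eq_zero.mp hk
    exact hsg.1 V U (Finset.sdiff_eq_empty_iff_subset.mp this) hV
  | succ k ih =>
    intro V hk hV h1 hc
    have step : ∀ i j, j ∈ V → j ∉ U → i ∈ U → i ∉ V → Desir χ i j →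
        ((insert i (V.erase j)) ∩ N1).card ≤ (U ∩ N1).card → χ U := by
      intro i j hjV hjU hiU hiV hd hcd
      refine ih (insert i (V.erase j)) ?_ (hd V hjV hiV hV) hcd ?_
      · have : insert i (V.erase j) \ U = (V \ U).erase j := by
          ext x
          simp only [Finset.mem_sdiff, Finset.mem_insert, Finset.mem_erase]
          constructor
          · rintro ⟨rfl | h, hx⟩
            · exact absurd hiU hx
            · tauto
          · tauto
        rw [this, Finset.card_erase_of_mem (by simp [hjV, hjU]), hk]
        rfl
      · rw [Finset.card_insert_of_notMem (by simp [hiV]), Finset.card_erase_of_mem hjV]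
        have := Finset.card_pos.mpr ⟨j, hjV⟩
        omega
    by_cases hex : ∃ j ∈ V ∩ N1, j ∉ U
    · obtain ⟨j, hj, hjU⟩ := hex
      obtain ⟨hjV, hj1⟩ := Finset.mem_inter.mp hj
      have : ∃ i ∈ U ∩ N1, i ∉ V ∩ N1 := by
        by_contra hcon
        push Not at hcon
        have hsub : U ∩ N1 ⊆ V ∩ N1 := hcon
        have := Finset.eq_of_subset_of_card_le hsub h1
        rw [← this] at hj
        exact hjU (Finset.mem_inter.mp hj).1
      obtain ⟨i, hi, hiV⟩ := this
      obtain ⟨hiU, hi1⟩ := Finset.mem_inter.mp hi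
      have hiV' : i ∉ V := fun h => hiV (Finset.mem_inter.mpr ⟨h, hi1⟩)
      refine step i j hjV hjU hiU hiV' (desir_of_mem h2 fun _ => hi1) ?_
      have : insert i (V.erase j) ∩ N1 = insert i ((V ∩ N1).erase j) := by
        rw [Finset.insert_inter_of_mem hi1, Finset.erase_inter]
      rw [this, Finset.card_insert_of_notMem (by simp [hiV']), Finset.card_erase_of_mem hj]
      have := Finset.card_pos.mpr ⟨j, hj⟩
      omega
    · push Not at hex
      obtain ⟨j, hj⟩ : (V \ U).Nonempty := Finset.card_pos.mp (by omega)
      obtain ⟨hjV, hjU⟩ := Finset.mem_sdiff.mp hj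
      have : ∃ i ∈ U, i ∉ V := by
        by_contra hcon
        push Not at hcon
        have hsub : U ⊆ V := hcon
        have := Finset.eq_of_subset_of_card_le hsub hc
        exact hjU (this ▸ hjV)
      obtain ⟨i, hiU, hiV⟩ := this
      have hj1 : j ∉ N1 := fun h => hjU (hex j (Finset.mem_inter.mpr ⟨hjV, h⟩))
      refine step i j hjV hjU hiU hiV (desir_of_mem h2 fun h => absurd h hj1) ?_
      apply Finset.card_le_card
      intro x hx
      simp only [Finset.mem_inter, Finset.mem_insert, Finset.mem_erase] at hx
      obtain ⟨rfl | hx, hx1⟩ := hx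
      · exact Finset.mem_inter.mpr ⟨hiU, hx1⟩
      · exact Finset.mem_inter.mpr ⟨hex x (Finset.mem_inter.mpr ⟨hx.2, hx1⟩), hx1⟩

theorem card_split {n : ℕ} {χ : Finset (Fin n) → Prop} {N1 N2 : Finset (Fin n)}
    (h2 : TwoTypes χ N1 N2) (U : Finset (Fin n)) :
    U.card = (U ∩ N1).card + (U ∩ N2).card := by
  have h := levW_eq h2 1 1 U
  simp [levW] at h
  exact_mod_cast h

theorem sum_lt {n : ℕ} {χ : Finset (Fin n) → Prop} {N1 N2 : Finset (Fin n)}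
    (hsg : SimpleGame n χ) (h2 : TwoTypes χ N1 N2) {U V : Finset (Fin n)}
    (hU : ShiftMinWin χ U) (hV : χ V) (h1 : (V ∩ N1).card < (U ∩ N1).card) :
    U.card < V.card := by
  classical
  by_contra hle
  push Not at hle
  obtain ⟨i, hi⟩ : (U ∩ N1).Nonempty := Finset.card_pos.mp (by omega)
  obtain ⟨hiU, hi1⟩ := Finset.mem_inter.mp hi
  have hce : (U.erase i ∩ N1).card = (U ∩ N1).card - 1 := by
    rw [Finset.erase_inter, Finset.card_erase_of_mem hi]
  have hpos := Finset.card_pos.mpr ⟨i, hiU⟩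
  rcases hle.lt_or_eq with hlt | heq
  · refine hU.2.1 i hiU (dom_win hsg h2 _ _ V rfl hV ?_ ?_)
    · omega
    · rw [Finset.card_erase_of_mem hiU]; omega
  · have hs1 := card_split h2 U
    have hs2 := card_split h2 V
    have : ∃ j ∈ V ∩ N2, j ∉ U ∩ N2 := by
      by_contra hcon
      push Not at hcon
      have := Finset.card_le_card (show V ∩ N2 ⊆ U ∩ N2 from hcon)
      omega
    obtain ⟨j, hj, hjU⟩ := this
    obtain ⟨hjV, hj2⟩ := Finset.mem_inter.mp hj
    have hjU' : j ∉ U := fun h => hjU (Finset.mem_inter.mpr ⟨h, hj2⟩)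
    refine hU.2.2 i hiU j hjU' (h2.2.2.2.2.2.2 i hi1 j hj2)
      (dom_win hsg h2 _ _ V rfl hV ?_ ?_)
    · have : (U.erase i ∩ N1).card ≤ (insert j (U.erase i) ∩ N1).card :=
        Finset.card_le_card (Finset.inter_subset_inter_right (Finset.subset_insert _ _))
      omega
    · rw [Finset.card_insert_of_notMem (by simp [hjU']), Finset.card_erase_of_mem hiU]
      omega

/-- Existence of a coalition of a prescribed type. -/
theorem exists_type {n : ℕ} {χ : Finset (Fin n) → Prop} {N1 N2 : Finset (Fin n)}
    (h2 : TwoTypes χ N1 N2) {x y : ℕ} (hx : x ≤ N1.card) (hy : y ≤ N2.card) :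
    ∃ U : Finset (Fin n), (U ∩ N1).card = x ∧ (U ∩ N2).card = y := by
  classical
  obtain ⟨A, hA, rfl⟩ := Finset.exists_subset_card_eq hx
  obtain ⟨B, hB, rfl⟩ := Finset.exists_subset_card_eq hy
  have hd := h2.2.2.1
  have hd' : ∀ i, i ∈ N1 → i ∉ N2 := fun i h => Finset.disjoint_left.mp hd h
  refine ⟨A ∪ B, congrArg _ ?_, congrArg _ ?_⟩
  · ext i
    have := hd' i
    have := @hA i
    have := @hB i
    simp only [Finset.mem_inter, Finset.mem_union]
    tauto
  · ext i
    have := hd' i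
    have := @hA i
    have := @hB i
    simp only [Finset.mem_inter, Finset.mem_union]
    tauto

/-- A lattice point just below the segment from `(c, d)` to `(a, b)`. -/
theorem lattice_pt (a b c d : ℕ) (hac : c < a) (hbd : b < d) :
    ∃ P S g x y : ℕ, 0 < P ∧ 0 < S ∧ 0 < g ∧ a = c + g * P ∧ d = b + g * S ∧
      c ≤ x ∧ x ≤ a ∧ b ≤ y ∧ y ≤ d ∧ S * x + P * y + 1 = S * c + P * d := by
  obtain ⟨p, rfl⟩ := Nat.exists_eq_add_of_lt hac
  obtain ⟨s, rfl⟩ := Nat.exists_eq_add_of_lt hbd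
  obtain ⟨P, S, hcop, hP, hS⟩ := Nat.exists_coprime (p + 1) (s + 1)
  set g := Nat.gcd (p + 1) (s + 1) with hg
  have hg0 : 0 < g := Nat.gcd_pos_of_pos_left _ (Nat.succ_pos p)
  have hP0 : 0 < P := by
    rcases Nat.eq_zero_or_pos P with h | h
    · simp [h] at hP
    · exact h
  have hS0 : 0 < S := by
    rcases Nat.eq_zero_or_pos S with h | h
    · simp [h] at hS
    · exact h
  have hb := Int.gcd_eq_gcd_ab (S : ℤ) (P : ℤ)
  have hgc : Int.gcd (S : ℤ) (P : ℤ) = 1 := by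
    rw [Int.gcd_natCast_natCast]; exact hcop.symm
  rw [hgc] at hb
  set A := Int.gcdA (S : ℤ) (P : ℤ)
  set B := Int.gcdB (S : ℤ) (P : ℤ)
  have hPz : (0 : ℤ) < P := by exact_mod_cast hP0
  have hSz : (0 : ℤ) < S := by exact_mod_cast hS0
  have hu0 := Int.emod_nonneg (-A) hPz.ne'
  have hu1 := Int.emod_lt_of_pos (-A) hPz
  have hum := Int.emod_add_mul_ediv (-A) (P : ℤ)
  set m := (-A) / (P : ℤ)
  obtain ⟨u, hu⟩ := Int.eq_ofNat_of_zero_le hu0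
  rw [hu] at hu0 hu1 hum
  -- S u + 1 = P k
  have hk : (S : ℤ) * u + 1 = P * (B - S * m) := by
    push_cast at hb
    linear_combination hb + (S : ℤ) * hum
  have hkpos : 0 < B - S * m := by
    by_contra hc
    push Not at hc
    nlinarith [mul_nonneg hSz.le hu0]
  obtain ⟨k, hkk⟩ := Int.eq_ofNat_of_zero_le hkpos.le
  rw [hkk] at hk hkpos
  have hku : k ≤ S := by
    by_contra hc
    push Not at hc
    have h1 : (S : ℤ) + 1 ≤ k := by exact_mod_cast hc
    nlinarith
  have hSg : S ≤ s + 1 := by rw [hS]; exact Nat.le_mul_of_pos_right _ hg0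
  have hPg : P ≤ p + 1 := by rw [hP]; exact Nat.le_mul_of_pos_right _ hg0
  have huP : u < P := by exact_mod_cast hu1
  refine ⟨P, S, g, c + u, b + s + 1 - k, hP0, hS0, hg0, ?_, ?_, ?_, ?_, ?_, ?_, ?_⟩
  · rw [add_assoc, hP, mul_comm]
  · rw [add_assoc, hS, mul_comm]
  · omega
  · omega
  · omega
  · omega
  · zify [show k ≤ b + s + 1 by omega]
    linear_combination hk

set_option maxHeartbeats 1000000 in
theorem stmt6 (n : ℕ) (χ : Finset (Fin n) → Prop) (hsg : SimpleGame n χ)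
    (hwt : IsWeighted χ) (N1 N2 : Finset (Fin n)) (h2 : TwoTypes χ N1 N2)
    (hnull : ∀ i, ¬ NullVoter χ i) (hr : 2 ≤ NumWinTypes2 χ N1 N2)
    (a b c d e f : ℕ)
    (hab : ∃ U, ShiftMinWin χ U ∧ (U ∩ N1).card = a ∧ (U ∩ N2).card = b)
    (hcd : ∃ U, ShiftMinWin χ U ∧ (U ∩ N1).card = c ∧ (U ∩ N2).card = d)
    (hac : c < a)
    (hef : ∃ U, ShiftMaxLose χ U ∧ (U ∩ N1).card = e ∧ (U ∩ N2).card = f)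
    (hdet : ((f : ℤ) * c + (a : ℤ) * d + (e : ℤ) * b) -
            ((f : ℤ) * a + (b : ℤ) * c + (e : ℤ) * d) ≠ 0)
    (w1 w2 q : ℝ) (hfeas : LPFeasible χ N1 N2 w1 w2 q)
    (heq1 : (a : ℝ) * w1 + (b : ℝ) * w2 = q)
    (heq2 : (c : ℝ) * w1 + (d : ℝ) * w2 = q)
    (heq3 : (e : ℝ) * w1 + (f : ℝ) * w2 = q - 1) :
    ((∃ k : ℕ, w1 = k) ∧ (∃ k : ℕ, w2 = k) ∧ (∃ k : ℕ, q = k)) ∧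
    ∀ w1' w2' q' : ℝ, LPFeasible χ N1 N2 w1' w2' q' → w1 ≤ w1' ∧ w2 ≤ w2' ∧ q ≤ q' := by
  classical
  obtain ⟨U1, hU1, ha, hb⟩ := hab
  obtain ⟨U2, hU2, hc, hd⟩ := hcd
  obtain ⟨U3, hU3, he, hf⟩ := hef
  have hsum : a + b < c + d := by
    have h := sum_lt hsg h2 hU1 hU2.1 (by omega)
    rw [card_split h2 U1, card_split h2 U2, ha, hb, hc, hd] at h
    exact h
  have hbd : b < d := by omega
  obtain ⟨P, S, g, x, y, hP, hS, hg, haP, hdS, hcx, hxa, hby, hyd, hxy⟩ := lattice_pt a b c d hac hbd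
  have hPS : P < S := by
    have h1 : g * P < g * S := by omega
    exact lt_of_mul_lt_mul_left h1 (Nat.zero_le g)
  have hPr : (0 : ℝ) < P := by exact_mod_cast hP
  have hSr : (0 : ℝ) < S := by exact_mod_cast hS
  have hgr : (0 : ℝ) < g := by exact_mod_cast hg
  have hPSr : (P : ℝ) + 1 ≤ S := by exact_mod_cast hPS
  have haR : (a : ℝ) = c + g * P := by exact_mod_cast haP
  have hdR : (d : ℝ) = b + g * S := by exact_mod_cast hdS
  have hxyR : (S : ℝ) * x + P * y + 1 = S * c + P * d := by exact_mod_cast hxy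
  have hprop : (P : ℝ) * w1 = S * w2 := by
    have : (g : ℝ) * (P * w1) = g * (S * w2) := by
      rw [haR] at heq1
      rw [hdR] at heq2
      linarith
    exact mul_left_cancel₀ hgr.ne' this
  obtain ⟨t, ht⟩ : ∃ t : ℝ, t = w2 / P := ⟨_, rfl⟩
  have hw2t : w2 = P * t := by rw [ht]; field_simp
  have hw1t : w1 = S * t := by
    apply mul_left_cancel₀ hPr.ne'
    rw [hprop, hw2t]; ring
  have ht0 : 0 < t := by
    have h0 : 0 ≤ t := by rw [ht]; exact div_nonneg hfeas.2.1 hPr.le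
    rcases h0.lt_or_eq with h | h
    · exact h
    · exfalso
      rw [hw1t, hw2t, ← h] at heq1 heq3
      linarith
  have hw2pos : 0 < w2 := by rw [hw2t]; positivity
  have hw12 : w2 < w1 := by
    rw [hw1t, hw2t]
    exact mul_lt_mul_of_pos_right (by linarith) ht0
  obtain ⟨hwin, hlose⟩ := lev_sep h2 hfeas hw2pos hw12
  have hxN : x ≤ N1.card := by
    have := Finset.card_le_card (Finset.inter_subset_right : U1 ∩ N1 ⊆ N1)
    omega
  have hyN : y ≤ N2.card := by
    have := Finset.card_le_card (Finset.inter_subset_right : U2 ∩ N2 ⊆ N2)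
    omega
  obtain ⟨V, hVx, hVy⟩ := exists_type h2 hxN hyN
  have hlevV : levW N1 w1 w2 V = q - t := by
    rw [levW_eq h2, hVx, hVy, ← heq2, hw1t, hw2t]
    linear_combination t * hxyR
  have hVl : ¬ χ V := fun h => by
    have := hwin V h
    linarith
  have ht1 : 1 ≤ t := by
    have := hlose V hVl
    linarith
  have hteq : t = 1 := by
    have hm : ((S : ℤ) * c + P * d - S * e - P * f : ℝ) * t = 1 := by
      push_cast
      rw [hw1t, hw2t] at heq2 heq3
      linarith
    have hmpos : (0 : ℝ) < (((S : ℤ) * c + P * d - S * e - P * f : ℤ) : ℝ) := by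
      push_cast
      push_cast at hm
      by_contra hcon
      push Not at hcon
      have hle := mul_nonpos_of_nonpos_of_nonneg hcon ht0.le
      rw [hm] at hle
      linarith
    have hm1 : (1 : ℤ) ≤ (S : ℤ) * c + P * d - S * e - P * f := by
      have : (0 : ℤ) < (S : ℤ) * c + P * d - S * e - P * f := by exact_mod_cast hmpos
      omega
    have hm1r : (1 : ℝ) ≤ (((S : ℤ) * c + P * d - S * e - P * f : ℤ) : ℝ) := by exact_mod_cast hm1
    push_cast at hm hm1r
    have hle := mul_le_mul_of_nonneg_right hm1r ht0.le
    rw [hm, one_mul] at hle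
    exact le_antisymm hle ht1
  rw [hteq, mul_one] at hw1t hw2t
  rw [hteq] at hlevV
  have hqe : q = S * x + P * y + 1 := by
    rw [← heq2, hw1t, hw2t]; linarith
  have hVmax : ShiftMaxLose χ V := by
    have hwin' : ∀ W, q - 1 < levW N1 w1 w2 W → χ W := fun W hW => by
      by_contra hcon
      linarith [hlose W hcon]
    refine ⟨hVl, fun j hj => hwin' _ ?_, fun j hj i hi hij => hwin' _ ?_⟩
    · rw [levW_insert _ _ _ hj, hlevV]
      split_ifs <;> linarith
    · have hij' := strict_types h2 hij
      rw [levW_insert _ _ _ (by simp [hi]), levW_erase _ _ _ hj, if_pos hij'.1,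
        if_neg hij'.2, hlevV]
      linarith
  refine ⟨⟨⟨S, hw1t⟩, ⟨P, hw2t⟩, ⟨S * x + P * y + 1, by push_cast; exact hqe⟩⟩, ?_⟩
  intro v1 v2 q' hf'
  obtain ⟨hv1, hv2, -, hfw, hfl⟩ := hf'
  have k1 := hfw U1 hU1
  have k2 := hfw U2 hU2
  have k3 := hfl V hVmax
  rw [ha, hb] at k1
  rw [hc, hd] at k2
  rw [hVx, hVy] at k3
  have hax : (0 : ℝ) ≤ a - x := by rw [sub_nonneg]; exact_mod_cast hxa
  have hxc : (0 : ℝ) ≤ x - c := by rw [sub_nonneg]; exact_mod_cast hcx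
  have hyb : (0 : ℝ) ≤ y - b := by rw [sub_nonneg]; exact_mod_cast hby
  have hdy : (0 : ℝ) ≤ d - y := by rw [sub_nonneg]; exact_mod_cast hyd
  have e1 : (S : ℝ) * (a - x) - P * (y - b) = 1 := by
    rw [haR]; rw [hdR] at hxyR; linarith
  have e2 : (P : ℝ) * (d - y) - S * (x - c) = 1 := by linarith
  have hD : ((a : ℝ) - x) * (d - y) - (y - b) * (x - c) = g := by
    apply mul_left_cancel₀ hPr.ne'
    have : (a : ℝ) - c = g * P := by rw [haR]; ring
    linear_combination ((a : ℝ) - x) * e2 + ((x : ℝ) - c) * e1 + this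
  have i1 : (y - b : ℝ) * (v2 - P) ≤ (a - x) * (v1 - S) := by linarith
  have i2 : (x - c : ℝ) * (v1 - S) ≤ (d - y) * (v2 - P) := by linarith
  have g1 : 0 ≤ (g : ℝ) * (v1 - S) := by
    rw [← hD]
    linarith [mul_le_mul_of_nonneg_left i1 hdy, mul_le_mul_of_nonneg_left i2 hyb]
  have g2 : 0 ≤ (g : ℝ) * (v2 - P) := by
    rw [← hD]
    linarith [mul_le_mul_of_nonneg_left i1 hxc, mul_le_mul_of_nonneg_left i2 hax]
  have r1 : (0 : ℝ) ≤ v1 - S := nonneg_of_mul_nonneg_right g1 hgr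
  have r2 : (0 : ℝ) ≤ v2 - P := nonneg_of_mul_nonneg_right g2 hgr
  refine ⟨by linarith, by linarith, ?_⟩
  have m1 : (0 : ℝ) ≤ x * (v1 - S) := mul_nonneg (Nat.cast_nonneg x) r1
  have m2 : (0 : ℝ) ≤ y * (v2 - P) := mul_nonneg (Nat.cast_nonneg y) r2
  rw [hqe]
  linarith
end

section
/- Let χ be a weighted game on n voters with exactly two types of voters, without null voters, and with at least two distinct types of shift-minimal winning coalitions (r ≥ 2). Suppose (a, b) is the type of a shift-minimal winning coalition of χ, (c, d) and (e, f) with e > c are types of shift-maximal losing coalitions of χ, the determinant f·c − f·a + a·d − b·c − e·d + e·b is nonzero, and (w1, w2, q) is an LP-feasible triple of nonnegative reals satisfying a·w1 + b·w2 = q, c·w1 + d·w2 = q − 1 and e·w1 + f·w2 = q − 1. Then w1, w2 and q are nonnegative integers, and every LP-feasible triple (w1', w2', q') satisfies w1' ≥ w1, w2' ≥ w2 and q' ≥ q. -/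
theorem aux_bez (p s : ℤ) (hp : 0 < p) (hs : 0 < s) (h : IsCoprime p s) :
    ∃ α β : ℤ, p * α + s * β = 1 ∧ 0 < α ∧ α ≤ s ∧ -p < β ∧ β ≤ 0 := by
  obtain ⟨u, v, huv⟩ := h
  have h1 := Int.emod_add_mul_ediv (u - 1) s
  have h2 := Int.emod_nonneg (u - 1) hs.ne'
  have h3 := Int.emod_lt_of_pos (u - 1) hs
  set r := (u - 1) % s
  set k := (u - 1) / s
  have key : p * (r + 1) + s * (v + p * k) = 1 := by
    have : u = r + s * k + 1 := by linarith
    rw [this] at huv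
    linarith
  refine ⟨r + 1, v + p * k, key, by omega, by omega, ?_, ?_⟩
  · by_contra hcon
    push Not at hcon
    nlinarith
  · by_contra hcon
    push Not at hcon
    nlinarith

theorem aux_shift {n : ℕ} (χ : Finset (Fin n) → Prop) (hsg : SimpleGame n χ)
    (N1 N2 : Finset (Fin n)) (h2 : TwoTypes χ N1 N2) (k : ℕ) :
    ∀ U V : Finset (Fin n), (U \ V).card = k → χ U →
      (U ∩ N1).card ≤ (V ∩ N1).card →
      (U ∩ N1).card + (U ∩ N2).card ≤ (V ∩ N1).card + (V ∩ N2).card → χ V := by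
  obtain ⟨-, -, hdis, hun, h11, h22, h12⟩ := h2
  have hmem : ∀ i, i ∈ N1 ∨ i ∈ N2 := fun i => by
    rw [← Finset.mem_union, hun]; exact Finset.mem_univ i
  have hnot : ∀ i, i ∈ N1 → i ∉ N2 := fun i hi hj => Finset.disjoint_left.mp hdis hi hj
  induction k with
  | zero =>
    intro U V hk hU _ _
    refine hsg.1 U V ?_ hU
    rwa [Finset.card_eq_zero, Finset.sdiff_eq_empty_iff_subset] at hk
  | succ k ih =>
    intro U V hk hU hc1 hc2
    -- generic replacement step
    have step : ∀ u v, u ∈ U → u ∉ V → v ∈ V → v ∉ U → Desir χ v u →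
        (insert v (U.erase u) \ V).card = k ∧ χ (insert v (U.erase u)) := by
      intro u v hu huV hv hvU hd
      refine ⟨?_, hd U hu hvU hU⟩
      have : insert v (U.erase u) \ V = (U \ V).erase u := by
        ext x; simp only [Finset.mem_sdiff, Finset.mem_insert, Finset.mem_erase]
        constructor
        · rintro ⟨rfl | h, h'⟩
          · exact absurd hv h'
          · exact ⟨h.1, h.2, h'⟩
        · rintro ⟨h, h', h''⟩
          exact ⟨Or.inr ⟨h, h'⟩, h''⟩
      rw [this, Finset.card_erase_of_mem (by simp [hu, huV]), hk]; rfl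
    have cnt : ∀ (N : Finset (Fin n)) u v, u ∈ U → v ∉ U →
        ((insert v (U.erase u)) ∩ N).card + (if u ∈ N then 1 else 0)
          = (U ∩ N).card + (if v ∈ N then 1 else 0) := by
      intro N u v hu hv
      have e1 : ∀ W : Finset (Fin n), (W ∩ N).card = ∑ i ∈ W, if i ∈ N then 1 else 0 := by
        intro W; rw [← Finset.filter_mem_eq_inter, Finset.card_filter]
      rw [e1, e1, Finset.sum_insert (by simp [hv]), ← Finset.sum_erase_add U _ hu]
      ring
    have hne : (U \ V).Nonempty := by rw [← Finset.card_pos]; omega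
    by_cases hN1 : ∃ u, u ∈ U ∧ u ∉ V ∧ u ∈ N1
    · obtain ⟨u, huU, huV, huN⟩ := hN1
      have : ∃ v, v ∈ V ∧ v ∉ U ∧ v ∈ N1 := by
        by_contra hcon
        push Not at hcon
        have hss : (V ∩ N1) ⊂ (U ∩ N1) := by
          rw [Finset.ssubset_iff_of_subset]
          · exact ⟨u, by simp [huU, huN], by simp [huV]⟩
          · intro x hx
            rw [Finset.mem_inter] at hx ⊢
            refine ⟨?_, hx.2⟩
            by_contra hxU
            exact hcon x hx.1 hxU hx.2
        have := Finset.card_lt_card hss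
        omega
      obtain ⟨v, hvV, hvU, hvN⟩ := this
      obtain ⟨s1, s2⟩ := step u v huU huV hvV hvU (h11 v hvN u huN).1
      have c1 := cnt N1 u v huU hvU
      have c2 := cnt N2 u v huU hvU
      simp only [huN, hvN, hnot u huN, hnot v hvN, if_true, if_false] at c1 c2
      exact ih _ V s1 s2 (by omega) (by omega)
    · push Not at hN1
      obtain ⟨u, hu⟩ := hne
      rw [Finset.mem_sdiff] at hu
      obtain ⟨huU, huV⟩ := hu
      have huN1 : u ∉ N1 := hN1 u huU huV
      have huN : u ∈ N2 := (hmem u).resolve_left huN1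
      by_cases hv2 : ∃ v, v ∈ V ∧ v ∉ U ∧ v ∈ N2
      · obtain ⟨v, hvV, hvU, hvN⟩ := hv2
        have hvN1 : v ∉ N1 := fun h => hnot v h hvN
        obtain ⟨s1, s2⟩ := step u v huU huV hvV hvU (h22 v hvN u huN).1
        have c1 := cnt N1 u v huU hvU
        have c2 := cnt N2 u v huU hvU
        simp only [huN, hvN, huN1, hvN1, if_true, if_false] at c1 c2
        exact ih _ V s1 s2 (by omega) (by omega)
      · push Not at hv2
        have hss : (V ∩ N2) ⊂ (U ∩ N2) := by
          rw [Finset.ssubset_iff_of_subset]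
          · exact ⟨u, by simp [huU, huN], by simp [huV]⟩
          · intro x hx
            rw [Finset.mem_inter] at hx ⊢
            refine ⟨?_, hx.2⟩
            by_contra hxU
            exact hv2 x hx.1 hxU hx.2
        have hlt := Finset.card_lt_card hss
        have : ∃ v, v ∈ V ∧ v ∉ U ∧ v ∈ N1 := by
          by_contra hcon
          push Not at hcon
          have : (V ∩ N1) ⊆ (U ∩ N1) := by
            intro x hx
            rw [Finset.mem_inter] at hx ⊢
            refine ⟨?_, hx.2⟩
            by_contra hxU
            exact hcon x hx.1 hxU hx.2
          have := Finset.card_le_card this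
          omega
        obtain ⟨v, hvV, hvU, hvN⟩ := this
        obtain ⟨s1, s2⟩ := step u v huU huV hvV hvU (h12 v hvN u huN).1
        have c1 := cnt N1 u v huU hvU
        have c2 := cnt N2 u v huU hvU
        simp only [huN, hvN, huN1, hnot v hvN, if_true, if_false] at c1 c2
        exact ih _ V s1 s2 (by omega) (by omega)

theorem aux_cd {n : ℕ} (χ : Finset (Fin n) → Prop) (hsg : SimpleGame n χ)
    (N1 N2 : Finset (Fin n)) (h2 : TwoTypes χ N1 N2) (U V : Finset (Fin n))
    (hU : ShiftMaxLose χ U) (hV : ShiftMaxLose χ V)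
    (hlt : (U ∩ N1).card < (V ∩ N1).card) :
    (V ∩ N1).card + (V ∩ N2).card < (U ∩ N1).card + (U ∩ N2).card := by
  by_contra hcon
  push Not at hcon
  have hsh := fun W h => aux_shift χ hsg N1 N2 h2 _ W V rfl h
  obtain ⟨-, -, hdis, hun, h11, h22, h12⟩ := h2
  have hnot : ∀ i, i ∈ N1 → i ∉ N2 := fun i hi hj => Finset.disjoint_left.mp hdis hi hj
  have e1 : ∀ N W : Finset (Fin n), (W ∩ N).card = ∑ i ∈ W, if i ∈ N then 1 else 0 := by
    intro N W; rw [← Finset.filter_mem_eq_inter, Finset.card_filter]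
  have : ∃ i, i ∈ N1 ∧ i ∉ U := by
    by_contra h
    push Not at h
    have h1 : (V ∩ N1) ⊆ (U ∩ N1) := by
      intro x hx
      rw [Finset.mem_inter] at hx ⊢
      exact ⟨h x hx.2, hx.2⟩
    have := Finset.card_le_card h1
    omega
  obtain ⟨i, hi, hiU⟩ := this
  by_cases hj : ∃ j, j ∈ U ∧ j ∈ N2
  · obtain ⟨j, hjU, hj2⟩ := hj
    have hj1 : j ∉ N1 := fun h => hnot j h hj2
    have hw := hU.2.2 j hjU i hiU (h12 i hi j hj2)
    refine hV.1 (hsh _ hw ?_ ?_) <;>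
    · simp only [e1, ← Finset.sum_erase_add U _ hjU] at hlt hcon
      simp only [e1]
      simp only [Finset.sum_insert (show i ∉ U.erase j by simp [hiU])]
      simp only [hi, hj2, hj1, hnot i hi, if_true, if_false] at hlt hcon ⊢
      omega
  · have h0 : ∑ k ∈ U, (if k ∈ N2 then 1 else 0) = 0 := by
      apply Finset.sum_eq_zero
      intro k hk
      rw [if_neg]
      exact fun h => hj ⟨k, hk, h⟩
    have hw := hU.2.1 i hiU
    refine hV.1 (hsh _ hw ?_ ?_) <;>
    · simp only [e1] at hlt hcon
      simp only [e1]
      simp only [Finset.sum_insert hiU]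
      simp only [hi, hnot i hi, if_true, if_false] at hlt hcon ⊢
      omega

theorem aux_lev {n : ℕ} (χ : Finset (Fin n) → Prop)
    (N1 N2 : Finset (Fin n)) (h2 : TwoTypes χ N1 N2) (w1 w2 : ℝ) (U : Finset (Fin n)) :
    ((U ∩ N1).card : ℝ) * w1 + ((U ∩ N2).card : ℝ) * w2
      = ∑ i ∈ U, if i ∈ N1 then w1 else w2 := by
  obtain ⟨-, -, hdis, hun, -⟩ := h2
  have hmem : ∀ i, i ∈ N1 ∨ i ∈ N2 := fun i => by
    rw [← Finset.mem_union, hun]; exact Finset.mem_univ i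
  have hnot : ∀ i, i ∈ N1 → i ∉ N2 := fun i hi hj => Finset.disjoint_left.mp hdis hi hj
  have e1 : ∀ N : Finset (Fin n), ((U ∩ N).card : ℝ) = ∑ i ∈ U, if i ∈ N then 1 else 0 := by
    intro N; rw [← Finset.filter_mem_eq_inter, Finset.card_filter]; push_cast; rfl
  rw [e1, e1, Finset.sum_mul, Finset.sum_mul, ← Finset.sum_add_distrib]
  apply Finset.sum_congr rfl
  intro i _
  by_cases hi : i ∈ N1
  · simp [hi, hnot i hi]
  · simp [hi, (hmem i).resolve_left hi]

theorem aux_strict {n : ℕ} (χ : Finset (Fin n) → Prop)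
    (N1 N2 : Finset (Fin n)) (h2 : TwoTypes χ N1 N2) (i j : Fin n) (h : StrictDesir χ i j) :
    i ∈ N1 ∧ j ∉ N1 := by
  obtain ⟨-, -, hdis, hun, h11, h22, h12⟩ := h2
  have hmem : ∀ i, i ∈ N1 ∨ i ∈ N2 := fun i => by
    rw [← Finset.mem_union, hun]; exact Finset.mem_univ i
  rcases hmem i with hi | hi <;> rcases hmem j with hj | hj
  · exact absurd (h11 i hi j hj).2 h.2
  · exact ⟨hi, fun h' => Finset.disjoint_left.mp hdis h' hj⟩
  · exact absurd (h12 j hj i hi).1 h.2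
  · exact absurd (h22 i hi j hj).2 h.2

/-- feasible strict weights separate all winning from all losing coalitions. -/
theorem aux_sep {n : ℕ} (χ : Finset (Fin n) → Prop) (hsg : SimpleGame n χ)
    (N1 N2 : Finset (Fin n)) (h2 : TwoTypes χ N1 N2) (w1 w2 q : ℝ)
    (hf : LPFeasible χ N1 N2 w1 w2 q) (hw2 : 0 < w2) (hw : w2 < w1) :
    (∀ U, χ U → q ≤ ∑ i ∈ U, if i ∈ N1 then w1 else w2) ∧
    (∀ U, ¬ χ U → ∑ i ∈ U, (if i ∈ N1 then w1 else w2) ≤ q - 1) := by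
  classical
  obtain ⟨-, -, -, hwin, hlos⟩ := hf
  simp only [aux_lev χ N1 N2 h2] at hwin hlos
  have hpos : ∀ i : Fin n, 0 < (if i ∈ N1 then w1 else w2) := by
    intro i; split_ifs <;> linarith
  have hsd : ∀ i j, StrictDesir χ i j →
      (if j ∈ N1 then w1 else w2) < (if i ∈ N1 then w1 else w2) := by
    intro i j h
    obtain ⟨h1, h3⟩ := aux_strict χ N1 N2 h2 i j h
    simp [h1, h3, hw]
  set v : Fin n → ℝ := fun i => if i ∈ N1 then w1 else w2 with hv
  have hwapp : ∀ i, (if i ∈ N1 then w1 else w2) = v i := fun i => rfl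
  simp only [hwapp] at *
  constructor
  · obtain ⟨M, hM, hmin⟩ := Finset.exists_min_image (Finset.univ.filter χ)
      (fun U => ∑ i ∈ U, v i) ⟨Finset.univ, by simpa using hsg.2.2⟩
    simp only [Finset.mem_filter, Finset.mem_univ, true_and] at hM hmin
    have hM' : ShiftMinWin χ M := by
      refine ⟨hM, ?_, ?_⟩
      · intro i hi h
        have := hmin _ h
        rw [← Finset.sum_erase_add M _ hi] at this
        linarith [hpos i]
      · intro i hi j hj hs h
        have := hmin _ h
        rw [← Finset.sum_erase_add M _ hi, Finset.sum_insert (by simp [hj])] at this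
        linarith [hsd i j hs]
    intro U hU
    exact (hwin M hM').trans (hmin U hU)
  · obtain ⟨M, hM, hmax⟩ := Finset.exists_max_image (Finset.univ.filter (fun U => ¬ χ U))
      (fun U => ∑ i ∈ U, v i) ⟨∅, by simpa using hsg.2.1⟩
    simp only [Finset.mem_filter, Finset.mem_univ, true_and] at hM hmax
    have hM' : ShiftMaxLose χ M := by
      refine ⟨hM, ?_, ?_⟩
      · intro i hi
        by_contra h
        have := hmax _ h
        rw [Finset.sum_insert hi] at this
        linarith [hpos i]
      · intro j hj i hi hs
        by_contra h
        have := hmax _ h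
        rw [← Finset.sum_erase_add M _ hj, Finset.sum_insert (by simp [hi])] at this
        linarith [hsd i j hs]
    intro U hU
    exact (hmax U hU).trans (hlos M hM')

set_option maxHeartbeats 1000000 in
theorem stmt7 (n : ℕ) (χ : Finset (Fin n) → Prop) (hsg : SimpleGame n χ)
    (hwt : IsWeighted χ) (N1 N2 : Finset (Fin n)) (h2 : TwoTypes χ N1 N2)
    (hnull : ∀ i, ¬ NullVoter χ i) (hr : 2 ≤ NumWinTypes2 χ N1 N2)
    (a b c d e f : ℕ)
    (hab : ∃ U, ShiftMinWin χ U ∧ (U ∩ N1).card = a ∧ (U ∩ N2).card = b)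
    (hcd : ∃ U, ShiftMaxLose χ U ∧ (U ∩ N1).card = c ∧ (U ∩ N2).card = d)
    (hef : ∃ U, ShiftMaxLose χ U ∧ (U ∩ N1).card = e ∧ (U ∩ N2).card = f)
    (hce : c < e)
    (hdet : ((f : ℤ) * c + (a : ℤ) * d + (e : ℤ) * b) -
            ((f : ℤ) * a + (b : ℤ) * c + (e : ℤ) * d) ≠ 0)
    (w1 w2 q : ℝ) (hfeas : LPFeasible χ N1 N2 w1 w2 q)
    (heq1 : (a : ℝ) * w1 + (b : ℝ) * w2 = q)
    (heq2 : (c : ℝ) * w1 + (d : ℝ) * w2 = q - 1)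
    (heq3 : (e : ℝ) * w1 + (f : ℝ) * w2 = q - 1) :
    ((∃ k : ℕ, w1 = k) ∧ (∃ k : ℕ, w2 = k) ∧ (∃ k : ℕ, q = k)) ∧
    ∀ w1' w2' q' : ℝ, LPFeasible χ N1 N2 w1' w2' q' → w1 ≤ w1' ∧ w2 ≤ w2' ∧ q ≤ q' := by
  classical
  obtain ⟨UA, hUA, ha, hb⟩ := hab
  obtain ⟨UC, hUC, hc, hd⟩ := hcd
  obtain ⟨UE, hUE, he, hf⟩ := hef
  have hsum : e + f < c + d := by
    have := aux_cd χ hsg N1 N2 h2 UC UE hUC hUE (by omega)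
    omega
  have hfd : f < d := by omega
  -- positivity
  have hceR : (c : ℝ) < e := by exact_mod_cast hce
  have hfdR : (f : ℝ) < d := by exact_mod_cast hfd
  have hsumR : (e : ℝ) + f < c + d := by exact_mod_cast hsum
  have hprop : ((e : ℝ) - c) * w1 = ((d : ℝ) - f) * w2 := by linarith
  have hw2 : 0 < w2 := by
    rcases hfeas.2.1.lt_or_eq with h | h
    · exact h
    · exfalso
      rw [← h] at hprop heq1 heq2
      have : w1 = 0 := by
        have h3 : ((e : ℝ) - c) * w1 = 0 := by linarith
        rcases mul_eq_zero.mp h3 with h4 | h4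
        · linarith
        · exact h4
      rw [this] at heq1 heq2
      linarith
  have hw : w2 < w1 := by
    by_contra h
    push Not at h
    nlinarith
  obtain ⟨hwin, hlos⟩ := aux_sep χ hsg N1 N2 h2 w1 w2 q hfeas hw2 hw
  -- gcd decomposition
  obtain ⟨g, p, s, hg, hp, hs, hA, hB, hcop⟩ : ∃ g p s : ℤ, 0 < g ∧ 0 < p ∧ 0 < s ∧
      (d : ℤ) - f = g * p ∧ (e : ℤ) - c = g * s ∧ IsCoprime p s := by
    have hpos : 0 < Int.gcd ((d : ℤ) - f) ((e : ℤ) - c) :=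
      Int.gcd_pos_of_ne_zero_left _ (by omega)
    obtain ⟨p, s, hcop, hp, hs⟩ := Int.exists_gcd_one hpos
    have hgp : (0 : ℤ) < (Int.gcd ((d : ℤ) - f) ((e : ℤ) - c) : ℤ) := by exact_mod_cast hpos
    refine ⟨(Int.gcd ((d : ℤ) - f) ((e : ℤ) - c) : ℤ), p, s, hgp, ?_, ?_, ?_, ?_,
      Int.isCoprime_iff_gcd_eq_one.mpr hcop⟩
    · by_contra h
      push Not at h
      nlinarith
    · by_contra h
      push Not at h
      nlinarith
    · linarith
    · linarith
  obtain ⟨α, β, hαβ, hα0, hαs, hβp, hβ0⟩ := aux_bez p s hp hs hcop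
  have hgs : s ≤ g * s := by nlinarith
  have hgp : p ≤ g * p := by nlinarith
  obtain ⟨x, hx⟩ := Int.eq_ofNat_of_zero_le (show 0 ≤ (c : ℤ) + α by omega)
  obtain ⟨y, hy⟩ := Int.eq_ofNat_of_zero_le (show 0 ≤ (d : ℤ) + β by omega)
  have hxe : x ≤ e := by omega
  have hyd : y ≤ d := by omega
  have hx1 : x ≤ N1.card := by
    have := Finset.card_le_card (Finset.inter_subset_right (s₁ := UE) (s₂ := N1))
    omega
  have hy1 : y ≤ N2.card := by
    have := Finset.card_le_card (Finset.inter_subset_right (s₁ := UC) (s₂ := N2))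
    omega
  have hdis := h2.2.2.1
  obtain ⟨X, hXs, hXc⟩ := Finset.exists_subset_card_eq hx1
  obtain ⟨Y, hYs, hYc⟩ := Finset.exists_subset_card_eq hy1
  have hP1 : ((X ∪ Y) ∩ N1).card = x := by
    rw [Finset.union_inter_distrib_right, Finset.inter_eq_left.mpr hXs,
      Finset.disjoint_iff_inter_eq_empty.mp (hdis.symm.mono_left hYs), Finset.union_empty, hXc]
  have hP2 : ((X ∪ Y) ∩ N2).card = y := by
    rw [Finset.union_inter_distrib_right, Finset.inter_eq_left.mpr hYs,
      Finset.disjoint_iff_inter_eq_empty.mp (hdis.mono_left hXs), Finset.empty_union, hYc]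
  set P := X ∪ Y
  have hlevP := aux_lev χ N1 N2 h2 w1 w2 P
  rw [hP1, hP2] at hlevP
  -- real versions
  have hgR : (0 : ℝ) < g := by exact_mod_cast hg
  have hpR : (0 : ℝ) < p := by exact_mod_cast hp
  have hsR : (0 : ℝ) < s := by exact_mod_cast hs
  have hAR : (d : ℝ) - f = g * p := by exact_mod_cast hA
  have hBR : (e : ℝ) - c = g * s := by exact_mod_cast hB
  have hxR : (x : ℝ) = c + α := by exact_mod_cast hx.symm
  have hyR : (y : ℝ) = d + β := by exact_mod_cast hy.symm
  have hαβR : (p : ℝ) * α + s * β = 1 := by exact_mod_cast hαβ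
  obtain ⟨t, ht⟩ : ∃ t : ℝ, w2 = s * t := ⟨w2 / s, by field_simp⟩
  have ht1 : w1 = p * t := by
    rw [hAR, hBR, ht] at hprop
    have h3 : ((g : ℝ) * s) * w1 = (g * s) * (p * t) := by linarith
    exact mul_left_cancel₀ (by positivity) h3
  have htpos : 0 < t := by
    rw [ht] at hw2
    exact (mul_pos_iff_of_pos_left hsR).mp hw2
  have hlevP' : (x : ℝ) * w1 + y * w2 = q - 1 + t := by
    rw [hxR, hyR]
    have : (α : ℝ) * w1 + β * w2 = t := by
      rw [ht, ht1]
      linear_combination t * hαβR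
    linarith
  have hPwin : χ P := by
    by_contra h
    have := hlos P h
    linarith
  have htge : 1 ≤ t := by
    have := hwin P hPwin
    linarith
  have htone : t = 1 := by
    have hK : (((p * ((a : ℤ) - c) + s * ((b : ℤ) - d) : ℤ)) : ℝ) * t = 1 := by
      push_cast
      rw [ht, ht1] at heq1 heq2
      linarith
    have hKpos : 0 < (p * ((a : ℤ) - c) + s * ((b : ℤ) - d) : ℤ) := by
      by_contra h
      push Not at h
      have : (((p * ((a : ℤ) - c) + s * ((b : ℤ) - d) : ℤ)) : ℝ) ≤ 0 := by exact_mod_cast h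
      have h8 := mul_nonpos_of_nonpos_of_nonneg this htpos.le
      linarith
    have : (1 : ℝ) ≤ (((p * ((a : ℤ) - c) + s * ((b : ℤ) - d) : ℤ)) : ℝ) := by
      exact_mod_cast hKpos
    have h8 := mul_le_mul_of_nonneg_right this htpos.le
    linarith
  subst htone
  rw [mul_one] at ht ht1
  have hPmin : ShiftMinWin χ P := by
    refine ⟨hPwin, ?_, ?_⟩
    · intro i hi h
      have h5 := hwin _ h
      rw [← Finset.sum_erase_add P _ hi] at hlevP
      have : 0 < (if i ∈ N1 then w1 else w2) := by split_ifs <;> linarith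
      linarith
    · intro i hi j hj hstr h
      have h5 := hwin _ h
      rw [Finset.sum_insert (by simp [hj])] at h5
      rw [← Finset.sum_erase_add P _ hi] at hlevP
      obtain ⟨h6, h7⟩ := aux_strict χ N1 N2 h2 i j hstr
      simp only [h6, h7, if_true, if_false] at h5 hlevP
      linarith
  have hcR : (0 : ℝ) ≤ c := Nat.cast_nonneg c
  have hdR : (0 : ℝ) ≤ d := Nat.cast_nonneg d
  refine ⟨⟨⟨p.toNat, ?_⟩, ⟨s.toNat, ?_⟩, ⟨c * p.toNat + d * s.toNat + 1, ?_⟩⟩, ?_⟩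
  · have : ((p.toNat : ℤ) : ℝ) = p := by rw [Int.toNat_of_nonneg hp.le]
    rw [ht1, ← this]; norm_cast
  · have : ((s.toNat : ℤ) : ℝ) = s := by rw [Int.toNat_of_nonneg hs.le]
    rw [ht, ← this]; norm_cast
  · have h3 : ((p.toNat : ℤ) : ℝ) = p := by rw [Int.toNat_of_nonneg hp.le]
    have h4 : ((s.toNat : ℤ) : ℝ) = s := by rw [Int.toNat_of_nonneg hs.le]
    push_cast at h3 h4 ⊢
    rw [h3, h4, ← ht1, ← ht]
    linarith
  · intro w1' w2' q' ⟨_, _, _, hwin', hlos'⟩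
    have k1 := hwin' P hPmin
    have k2 := hlos' UC hUC
    have k3 := hlos' UE hUE
    rw [hP1, hP2, hxR, hyR] at k1
    rw [hc, hd] at k2
    rw [he, hf] at k3
    have m1 : 1 ≤ (α : ℝ) * w1' + β * w2' := by linarith
    have m2 : 1 ≤ ((α : ℝ) - g * s) * w1' + (β + g * p) * w2' := by
      rw [← hAR, ← hBR]; linarith
    have n1 : (0 : ℝ) ≤ g * p + β := by
      have : (0 : ℤ) ≤ g * p + β := by omega
      exact_mod_cast this
    have n2 : (0 : ℝ) ≤ -β := by
      have : (0 : ℤ) ≤ -β := by omega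
      exact_mod_cast this
    have n3 : (0 : ℝ) ≤ g * s - α := by
      have : (0 : ℤ) ≤ g * s - α := by omega
      exact_mod_cast this
    have n4 : (0 : ℝ) ≤ α := by exact_mod_cast hα0.le
    have r1 : w1 ≤ w1' := by
      have i1 := mul_le_mul_of_nonneg_left m1 n1
      have i2 := mul_le_mul_of_nonneg_left m2 n2
      have i3 : (g : ℝ) * p ≤ g * w1' := by
        have : (g : ℝ) * w1' = (g * p + β) * (α * w1' + β * w2')
            + (-β) * ((α - g * s) * w1' + (β + g * p) * w2') := by
          linear_combination (-(g : ℝ) * w1') * hαβR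
        linarith
      rw [ht1]
      exact le_of_mul_le_mul_left i3 hgR
    have r2 : w2 ≤ w2' := by
      have i1 := mul_le_mul_of_nonneg_left m1 n3
      have i2 := mul_le_mul_of_nonneg_left m2 n4
      have i3 : (g : ℝ) * s ≤ g * w2' := by
        have : (g : ℝ) * w2' = (g * s - α) * (α * w1' + β * w2')
            + α * ((α - g * s) * w1' + (β + g * p) * w2') := by
          linear_combination (-(g : ℝ) * w2') * hαβR
        linarith
      rw [ht]
      exact le_of_mul_le_mul_left i3 hgR
    refine ⟨r1, r2, ?_⟩
    have := mul_le_mul_of_nonneg_left r1 hcR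
    have := mul_le_mul_of_nonneg_left r2 hdR
    linarith
end

section
/- Let a > b > 3 be coprime positive integers and let l1 < l2 < l3 be natural numbers such that, setting ŵ_i = a·b − l_i − 1 for i = 1, 2, 3: (1) a < ŵ_i < a·b − 1, l_i is not representable by a and b, and l_i + 1 is representable by a and b; (2) for each i ∈ {1, 2, 3}, 0 < l1 + l2 + l3 − l_i − a·b < a·b and l1 + l2 + l3 − l_i − a·b is not representable by a and b; (3) 0 < l1 + l2 + l3 + 1 − 2·a·b < a·b and l1 + l2 + l3 + 1 − 2·a·b is representable by a and b. Let χ be the weighted game on 3 + b + a voters represented by [a·b; ŵ1, ŵ2 + 1, ŵ3 + 1, a, …, a (a group A of b voters), b, …, b (a group B of a voters)]. Then [a·b; ŵ1 + 1, ŵ2, ŵ3 + 1, a, …, a, b, …, b] and [a·b; ŵ1 + 1, ŵ2 + 1, ŵ3, a, …, a, b, …, b] are also integer representations of χ, and every integer representation [q'; w1, w2, w3, w4 on A, w5 on B] of χ that is constant on A and on B satisfies w4 ≥ a, w5 ≥ b, w1 ≥ ŵ1, w2 ≥ ŵ2, w3 ≥ ŵ3 and w1 + w2 + w3 ≥ ŵ1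 + ŵ2 + ŵ3 + 2; hence each of the three listed vectors attains the minimum possible total weight among such group-constant integer representations of χ. -/
lemma aux_bezout (a b : ℕ) (hb : 3 < b) (hba : b < a) (hco : Nat.Coprime a b) :
    ∃ p s : ℕ, p * a + s * b + 1 = a * b ∧ 1 ≤ p ∧ 1 ≤ s ∧ p < b ∧ s < a := by
  have hab : b * 4 ≤ a * b := by nlinarith
  obtain ⟨p, s, h⟩ := Nat.exists_add_mul_eq_of_gcd_dvd_of_mul_pred_le a b (a * b - 1)
    (by simp [hco.gcd_eq_one]) (by
      obtain ⟨a', rfl⟩ : ∃ a', a = a' + 1 := ⟨a - 1, by omega⟩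
      obtain ⟨b', rfl⟩ : ∃ b', b = b' + 1 := ⟨b - 1, by omega⟩
      simp only [Nat.pred_succ]
      apply Nat.le_sub_one_of_lt
      nlinarith)
  have h' : p * a + s * b + 1 = a * b := by omega
  refine ⟨p, s, h', ?_, ?_, ?_, ?_⟩
  · rcases Nat.eq_zero_or_pos p with rfl | hp
    · exfalso
      have : b ∣ 1 := by
        have h3 : b ∣ s * b + 1 := ⟨a, by linarith⟩
        exact (Nat.dvd_add_right (Dvd.intro_left s rfl)).1 h3
      have := Nat.le_of_dvd one_pos this
      omega
    · exact hp
  · rcases Nat.eq_zero_or_pos s with rfl | hp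
    · exfalso
      have : a ∣ 1 := by
        have h3 : a ∣ p * a + 1 := ⟨b, by linarith⟩
        exact (Nat.dvd_add_right (Dvd.intro_left p rfl)).1 h3
      have := Nat.le_of_dvd one_pos this
      omega
    · exact hp
  · by_contra hc
    push Not at hc
    nlinarith
  · by_contra hc
    push Not at hc
    nlinarith

/-- The cone of feasible increments is unimodular. -/
lemma aux_cone (a b p s α β X Y : ℤ) (hb : 0 < b) (hp : 1 ≤ p) (hpb : p < b) (ha : 0 < a)
    (h : p * a + s * b + 1 = a * b)
    (h1 : s * β ≤ (b - p) * α) (h2 : p * α ≤ (a - s) * β)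
    (hX : -a ≤ X) (hX' : X ≤ a) (hD : a ≤ X * a + Y * b) : 0 ≤ X * α + Y * β := by
  have hm : 0 ≤ X * (a - s) + Y * p := by
    have : 0 ≤ b * (X * (a - s) + Y * p) := by
      have e : b * (X * (a - s) + Y * p) = X + p * (X * a + Y * b) := by
        linear_combination (-X) * h
      rw [e]; nlinarith
    exact nonneg_of_mul_nonneg_right this hb
  have hn : 0 ≤ X * s + Y * (b - p) := by
    have : 0 ≤ b * (X * s + Y * (b - p)) := by
      have e : b * (X * s + Y * (b - p)) = (b - p) * (X * a + Y * b) - X := by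
        linear_combination X * h
      rw [e]; nlinarith
    exact nonneg_of_mul_nonneg_right this hb
  have e : X * α + Y * β = (X * (a - s) + Y * p) * ((b - p) * α - s * β)
      + (X * s + Y * (b - p)) * ((a - s) * β - p * α) := by
    linear_combination (X * α + Y * β) * h
  rw [e]
  exact add_nonneg (mul_nonneg hm (by linarith)) (mul_nonneg hn (by linarith))

lemma aux_sum (a b : ℕ) (w : Fin (3 + b + a) → ℕ) (c d : ℕ)
    (hc : ∀ i : Fin (3 + b + a), 3 ≤ (i : ℕ) → (i : ℕ) < 3 + b → w i = c)
    (hd : ∀ i : Fin (3 + b + a), 3 + b ≤ (i : ℕ) → w i = d)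
    (U : Finset (Fin (3 + b + a))) :
    ∑ i ∈ U, w i =
      (if (⟨0, by omega⟩ : Fin (3 + b + a)) ∈ U then w ⟨0, by omega⟩ else 0) +
      (if (⟨1, by omega⟩ : Fin (3 + b + a)) ∈ U then w ⟨1, by omega⟩ else 0) +
      (if (⟨2, by omega⟩ : Fin (3 + b + a)) ∈ U then w ⟨2, by omega⟩ else 0) +
      (Finset.univ.filter fun i : Fin b => Fin.castAdd a (Fin.natAdd 3 i) ∈ U).card * c +
      (Finset.univ.filter fun i : Fin a => Fin.natAdd (3 + b) i ∈ U).card * d := by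
  have e : ∑ i ∈ U, w i = ∑ i, if i ∈ U then w i else 0 := by
    rw [← Finset.sum_filter]; simp
  rw [e, Fin.sum_univ_add, Fin.sum_univ_add, Fin.sum_univ_three]
  congr 1
  · congr 1
    rw [Finset.card_filter, Finset.sum_mul]
    apply Finset.sum_congr rfl
    intro i _
    rw [hc (Fin.castAdd a (Fin.natAdd 3 i)) (by simp) (by simp)]
    split_ifs <;> simp
  · rw [Finset.card_filter, Finset.sum_mul]
    apply Finset.sum_congr rfl
    intro i _
    rw [hd (Fin.natAdd (3 + b) i) (by simp)]
    split_ifs <;> simp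

lemma aux_coal (a b : ℕ) (S : ℕ → Prop) [DecidablePred S] (u v : ℕ) (hu : u ≤ b) (hv : v ≤ a) :
    ∃ U : Finset (Fin (3 + b + a)), ∀ (w : Fin (3 + b + a) → ℕ) (c d : ℕ),
      (∀ i : Fin (3 + b + a), 3 ≤ (i : ℕ) → (i : ℕ) < 3 + b → w i = c) →
      (∀ i : Fin (3 + b + a), 3 + b ≤ (i : ℕ) → w i = d) →
      ∑ i ∈ U, w i =
      (if S 0 then w ⟨0, by omega⟩ else 0) +
      (if S 1 then w ⟨1, by omega⟩ else 0) +
      (if S 2 then w ⟨2, by omega⟩ else 0) + u * c + v * d := by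
  refine ⟨Finset.univ.filter fun i => ((i : ℕ) < 3 ∧ S i) ∨ (3 ≤ (i : ℕ) ∧ (i : ℕ) < 3 + u) ∨
    (3 + b ≤ (i : ℕ) ∧ (i : ℕ) < 3 + b + v), ?_⟩
  intro w c d hc hd
  rw [aux_sum a b w c d hc hd]
  have e1 : (Finset.univ.filter fun i : Fin b => Fin.castAdd a (Fin.natAdd 3 i) ∈
      (Finset.univ.filter fun i : Fin (3 + b + a) => ((i : ℕ) < 3 ∧ S i) ∨
        (3 ≤ (i : ℕ) ∧ (i : ℕ) < 3 + u) ∨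
        (3 + b ≤ (i : ℕ) ∧ (i : ℕ) < 3 + b + v))).card = u := by
    have : (Finset.univ.filter fun i : Fin b => (i : ℕ) < u).card = u := by
      rw [Fin.card_filter_val_lt]; omega
    refine Eq.trans ?_ this
    congr 1
    ext i
    have := i.isLt
    simp
  have e2 : (Finset.univ.filter fun i : Fin a => Fin.natAdd (3 + b) i ∈
      (Finset.univ.filter fun i : Fin (3 + b + a) => ((i : ℕ) < 3 ∧ S i) ∨
        (3 ≤ (i : ℕ) ∧ (i : ℕ) < 3 + u) ∨
        (3 + b ≤ (i : ℕ) ∧ (i : ℕ) < 3 + b + v))).card = v := by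
    have : (Finset.univ.filter fun i : Fin a => (i : ℕ) < v).card = v := by
      rw [Fin.card_filter_val_lt]; omega
    refine Eq.trans ?_ this
    congr 1
    ext i
    have := i.isLt
    simp
    omega
  rw [e1, e2]
  have z1 : ¬ (3 + b ≤ 1) := by omega
  have z2 : ¬ (3 + b ≤ 2) := by omega
  simp [z1, z2]

lemma aux_small (a b u v : ℕ) (ha : 0 < a) (hb : 0 < b) (h : u * a + v * b ≤ a * b) :
    u ≤ b ∧ v ≤ a := by
  constructor
  · exact Nat.le_of_mul_le_mul_right (by linarith [Nat.zero_le (v * b)] : u * a ≤ b * a) ha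
  · exact Nat.le_of_mul_le_mul_right (by linarith [Nat.zero_le (u * a)] : v * b ≤ a * b) hb

lemma aux_bd (a b p s u v c d q Z : ℕ) (hb3 : 3 < b) (hba : b < a)
    (hps : p * a + s * b + 1 = a * b) (hp : 1 ≤ p) (hpb : p < b) 
    (hca : a ≤ c) (hdb : b ≤ d) (hA : q ≤ b * c) (hB : q ≤ a * d) (hL : p * c + s * d < q)
    (hv : u * a + v * b + a < a * b) (hZ : q ≤ Z + u * c + v * d) :
    a * b ≤ Z + u * a + v * b := by
  have hub : u ≤ b := by
    by_contra hc
    push Not at hc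
    nlinarith
  have key := aux_cone a b p s (c - a) (d - b) (p - u) (s - v) (by omega) (by omega) (by omega)
    (by omega) (by exact_mod_cast hps)
    (by zify at *; nlinarith) (by zify at *; nlinarith) (by omega) (by omega)
    (by zify at *; nlinarith)
  zify at *
  nlinarith

set_option maxHeartbeats 2000000 in
theorem stmt12 (a b : ℕ) (hb3 : 3 < b) (hba : b < a) (hco : Nat.Coprime a b)
    (l : Fin 3 → ℕ) (hl01 : l 0 < l 1) (hl12 : l 1 < l 2)
    (h1 : ∀ i : Fin 3, a < a * b - l i - 1 ∧ a * b - l i - 1 < a * b - 1 ∧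
      ¬ Repre a b (l i) ∧ Repre a b (l i + 1))
    (h2 : ∀ i : Fin 3, a * b + l i < l 0 + l 1 + l 2 ∧
      l 0 + l 1 + l 2 < l i + 2 * (a * b) ∧
      ¬ Repre a b (l 0 + l 1 + l 2 - l i - a * b))
    (h3 : 2 * (a * b) < l 0 + l 1 + l 2 + 1 ∧ l 0 + l 1 + l 2 + 1 < 3 * (a * b) ∧
      Repre a b (l 0 + l 1 + l 2 + 1 - 2 * (a * b))) :
    (∀ k : Fin 3, IsRep
        (fun U : Finset (Fin (3 + b + a)) => a * b ≤ ∑ i ∈ U, Wvec 3 a b l 0 i)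
        (a * b) (Wvec 3 a b l k)) ∧
    (∀ (q' : ℕ) (w' : Fin (3 + b + a) → ℕ),
      IsRep (fun U : Finset (Fin (3 + b + a)) => a * b ≤ ∑ i ∈ U, Wvec 3 a b l 0 i) q' w' →
      (∀ i j : Fin (3 + b + a), 3 ≤ (i : ℕ) → (i : ℕ) < 3 + b →
        3 ≤ (j : ℕ) → (j : ℕ) < 3 + b → w' i = w' j) →
      (∀ i j : Fin (3 + b + a), 3 + b ≤ (i : ℕ) → 3 + b ≤ (j : ℕ) → w' i = w' j) →
      (∀ i : Fin (3 + b + a), 3 ≤ (i : ℕ) → (i : ℕ) < 3 + b → a ≤ w' i) ∧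
      (∀ i : Fin (3 + b + a), 3 + b ≤ (i : ℕ) → b ≤ w' i) ∧
      (∀ k : Fin 3, a * b - l k - 1 ≤ w' ⟨(k : ℕ), by omega⟩) ∧
      ((a * b - l 0 - 1) + (a * b - l 1 - 1) + (a * b - l 2 - 1) + 2 ≤
        w' ⟨0, by omega⟩ + w' ⟨1, by omega⟩ + w' ⟨2, by omega⟩) ∧
      (∀ k : Fin 3, ∑ i, Wvec 3 a b l k i ≤ ∑ i, w' i)) := by
  obtain ⟨p, s, hps, hp, hs, hpb, hsa⟩ := aux_bezout a b hb3 hba hco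
  have hWc : ∀ k, ∀ i : Fin (3 + b + a), 3 ≤ (i : ℕ) → (i : ℕ) < 3 + b →
      Wvec 3 a b l k i = a := by
    intro k i h h'
    have : ¬ (i : ℕ) < 3 := by omega
    simp [Wvec, this, h']
  have hWd : ∀ k, ∀ i : Fin (3 + b + a), 3 + b ≤ (i : ℕ) → Wvec 3 a b l k i = b := by
    intro k i h
    have h1 : ¬ (i : ℕ) < 3 := by omega
    have h2 : ¬ (i : ℕ) < 3 + b := by omega
    simp [Wvec, h1, h2]
  have hW0 : ∀ k, Wvec 3 a b l k ⟨0, by omega⟩ =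
      (a * b - l 0 - 1) + (if 0 = (k : ℕ) then 0 else 1) := by
    intro k; simp [Wvec]
  have hW1 : ∀ k, Wvec 3 a b l k ⟨1, by omega⟩ =
      (a * b - l 1 - 1) + (if 1 = (k : ℕ) then 0 else 1) := by
    intro k; simp [Wvec]
  have hW2 : ∀ k, Wvec 3 a b l k ⟨2, by omega⟩ =
      (a * b - l 2 - 1) + (if 2 = (k : ℕ) then 0 else 1) := by
    intro k; simp [Wvec]
  obtain ⟨g0, g0', n0, r0⟩ := h1 0
  obtain ⟨g1, g1', n1, r1⟩ := h1 1
  obtain ⟨g2, g2', n2, r2⟩ := h1 2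
  obtain ⟨f0, f0', m0⟩ := h2 0
  obtain ⟨f1, f1', m1⟩ := h2 1
  obtain ⟨f2, f2', m2⟩ := h2 2
  obtain ⟨k1, k2, rT⟩ := h3
  generalize hQ : a * b = Q at *
  generalize hL0 : l 0 = L0 at *
  generalize hL1 : l 1 = L1 at *
  generalize hL2 : l 2 = L2 at *
  constructor
  · intro k U
    simp only
    rw [aux_sum a b _ a b (hWc k) (hWd k) U, aux_sum a b _ a b (hWc 0) (hWd 0) U]
    rw [hW0, hW1, hW2, hW0, hW1, hW2]
    generalize (Finset.univ.filter fun i : Fin b => Fin.castAdd a (Fin.natAdd 3 i) ∈ U).card = x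
    generalize (Finset.univ.filter fun i : Fin a => Fin.natAdd (3 + b) i ∈ U).card = y
    have hrep : ∀ z, ¬ Repre a b z → x * a + y * b ≠ z := fun z hz h => hz ⟨x, y, h⟩
    have n0 := hrep _ n0
    have n1 := hrep _ n1
    have n2 := hrep _ n2
    have m0 := hrep _ m0
    have m1 := hrep _ m1
    have m2 := hrep _ m2
    clear hrep hW0 hW1 hW2 hWc hWd h1 h2
    generalize x * a = xa at *
    generalize y * b = yb at *
    have m0' : xa + yb + Q ≠ L1 + L2 := by omega
    have m1' : xa + yb + Q ≠ L0 + L2 := by omega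
    have m2' : xa + yb + Q ≠ L0 + L1 := by omega
    obtain ⟨A0, hA0⟩ : ∃ A, Q = A + L0 + 1 := ⟨Q - L0 - 1, by omega⟩
    obtain ⟨A1, hA1⟩ : ∃ A, Q = A + L1 + 1 := ⟨Q - L1 - 1, by omega⟩
    obtain ⟨A2, hA2⟩ : ∃ A, Q = A + L2 + 1 := ⟨Q - L2 - 1, by omega⟩
    have e0 : Q - L0 - 1 = A0 := by omega
    have e1 : Q - L1 - 1 = A1 := by omega
    have e2 : Q - L2 - 1 = A2 := by omega
    rw [e0, e1, e2]
    clear e0 e1 e2 m0 m1 m2 rT r0 r1 r2 hps hQ hp hs hpb hsa hba hb3 hco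
    clear g0 g1 g2 g0' g1' g2' k1 k2 f0 f1 f2 f0' f1' f2' hl01 hl12 hL0 hL1 hL2
    fin_cases k <;> simp only [Fin.isValue, Fin.val_zero, if_true] <;> norm_num <;> split_ifs <;> omega
  · intro q' w' hrep hA hB
    obtain ⟨c, hc⟩ : ∃ c, ∀ i : Fin (3 + b + a), 3 ≤ (i : ℕ) → (i : ℕ) < 3 + b → w' i = c :=
      ⟨w' ⟨3, by omega⟩, fun i h h' => hA _ _ h h' (by simp) (by simp; omega)⟩
    obtain ⟨d, hd⟩ : ∃ d, ∀ i : Fin (3 + b + a), 3 + b ≤ (i : ℕ) → w' i = d :=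
      ⟨w' ⟨3 + b, by omega⟩, fun i h => hB _ _ h (by simp)⟩
    have G : ∀ (S : ℕ → Prop) [DecidablePred S] (u v : ℕ), u ≤ b → v ≤ a →
        (Q ≤ (if S 0 then (Q - L0 - 1) + 0 else 0) + (if S 1 then (Q - L1 - 1) + 1 else 0) +
          (if S 2 then (Q - L2 - 1) + 1 else 0) + u * a + v * b ↔
        q' ≤ (if S 0 then w' ⟨0, by omega⟩ else 0) + (if S 1 then w' ⟨1, by omega⟩ else 0) +
          (if S 2 then w' ⟨2, by omega⟩ else 0) + u * c + v * d) := by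
      intro S _ u v hu hv
      obtain ⟨U, hU⟩ := aux_coal a b S u v hu hv
      have := hrep U
      simp only at this
      rw [hU _ a b (hWc 0) (hWd 0), hU _ c d hc hd, hW0, hW1, hW2] at this
      simpa using this
    generalize hw0 : w' ⟨0, by omega⟩ = w0 at *
    generalize hw1 : w' ⟨1, by omega⟩ = w1 at *
    generalize hw2 : w' ⟨2, by omega⟩ = w2 at *
    have GA : q' ≤ b * c := by
      have := (G (fun _ => False) b 0 le_rfl (by omega)).1 (by simp; linarith)
      simpa using this
    have GB : q' ≤ a * d := by
      have := (G (fun _ => False) 0 a (by omega) le_rfl).1 (by simp; linarith)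
      simpa using this
    have hlose : p * c + s * d < q' := by
      have := (G (fun _ => False) p s hpb.le hsa.le).not.1 (by simp; omega)
      simpa using this
    have hdb : b ≤ d := by
      zify at *
      have e1 : (s : ℤ) * d + 1 ≤ (b - p) * c := by linarith
      have e2 : (p : ℤ) * c + 1 ≤ (a - s) * d := by linarith
      have e3 : (p : ℤ) * (s * d + 1) ≤ p * ((b - p) * c) := 
        mul_le_mul_of_nonneg_left e1 (by linarith)
      have e4 : ((b : ℤ) - p) * (p * c + 1) ≤ (b - p) * ((a - s) * d) := 
        mul_le_mul_of_nonneg_left e2 (by linarith)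
      have e5 : ((b : ℤ) - p) * ((a - s) * d) = p * s * d + d := by
        linear_combination (-(d : ℤ)) * hps + d * hQ
      linarith
    have hca : a ≤ c := by
      zify at *
      have e1 : (s : ℤ) * d + 1 ≤ (b - p) * c := by linarith
      have e2 : (p : ℤ) * c + 1 ≤ (a - s) * d := by linarith
      have e3 : ((a : ℤ) - s) * (s * d + 1) ≤ (a - s) * ((b - p) * c) := 
        mul_le_mul_of_nonneg_left e1 (by linarith)
      have e4 : (s : ℤ) * (p * c + 1) ≤ s * ((a - s) * d) := 
        mul_le_mul_of_nonneg_left e2 (by linarith)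
      have e5 : ((a : ℤ) - s) * ((b - p) * c) = p * s * c + c := by
        linear_combination (-(c : ℤ)) * hps + c * hQ
      linarith
    have small : ∀ u v, u * a + v * b ≤ Q → u ≤ b ∧ v ≤ a := by
      intro u v h
      exact aux_small a b u v (by omega) (by omega) (by rw [hQ]; exact h)
    have bd : ∀ u v Z, u * a + v * b + a < Q → q' ≤ Z + u * c + v * d →
        Q ≤ Z + u * a + v * b := by
      intro u v Z h h'
      have := aux_bd a b p s u v c d q' Z hb3 hba (by rw [hps, hQ]) hp hpb hca hdb GA GB hlose
        (by rw [hQ]; exact h) h'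
      rwa [hQ] at this
    have B0 : Q - L0 - 1 ≤ w0 := by
      obtain ⟨u, v, h⟩ := r0
      obtain ⟨hu, hv⟩ := small u v (by omega)
      have := (G (fun i => i = 0) u v hu hv).1 (by simp; omega)
      have := bd u v w0 (by omega) (by simpa using this)
      omega
    have B1 : Q - L1 - 1 ≤ w1 := by
      obtain ⟨u, v, h⟩ := r1
      obtain ⟨hu, hv⟩ := small u v (by omega)
      have := (G (fun i => i = 1) u v hu hv).1 (by simp; omega)
      have := bd u v w1 (by omega) (by simpa using this)
      omega
    have B2 : Q - L2 - 1 ≤ w2 := by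
      obtain ⟨u, v, h⟩ := r2
      obtain ⟨hu, hv⟩ := small u v (by omega)
      have := (G (fun i => i = 2) u v hu hv).1 (by simp; omega)
      have := bd u v w2 (by omega) (by simpa using this)
      omega
    have BS : (Q - L0 - 1) + (Q - L1 - 1) + (Q - L2 - 1) + 2 ≤ w0 + w1 + w2 := by
      obtain ⟨u, v, h⟩ := rT
      obtain ⟨hu, hv⟩ := small u v (by omega)
      have := (G (fun i => True) u v hu hv).1 (by simp; omega)
      have := bd u v (w0 + w1 + w2) (by omega) (by simpa using this)
      omega
    refine ⟨fun i h h' => (hc i h h').symm ▸ hca, fun i h => (hd i h).symm ▸ hdb, ?_, BS, ?_⟩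
    · intro k
      fin_cases k
      · change Q - l 0 - 1 ≤ w' ⟨0, _⟩
        rw [hw0, hL0]
        exact B0
      · change Q - l 1 - 1 ≤ w' ⟨1, _⟩
        rw [hw1, hL1]
        exact B1
      · change Q - l 2 - 1 ≤ w' ⟨2, _⟩
        rw [hw2, hL2]
        exact B2
    · intro k
      rw [aux_sum a b _ a b (hWc k) (hWd k), aux_sum a b _ c d hc hd]
      rw [hW0, hW1, hW2, hw0, hw1, hw2]
      simp only [Finset.mem_univ, if_true, Finset.filter_true, Finset.card_univ, Fintype.card_fin]
      have e1 : b * a ≤ b * c := Nat.mul_le_mul_left _ hca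
      have e2 : a * b ≤ a * d := Nat.mul_le_mul_left _ hdb
      have : (if 0 = (k : ℕ) then 0 else 1) + (if 1 = (k : ℕ) then 0 else 1) +
        (if 2 = (k : ℕ) then 0 else 1) = 2 := by fin_cases k <;> simp
      omega
end
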